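/- The quotient P(V_{1,6})/(SL₂(ℂ)×SL₂(ℂ)) is rational: the field of SL₂×SL₂-invariant rational functions on the 13-dimensional projective space P(V_{1,6}) of bidegree (1,6) biforms is a purely transcendental extension of ℂ of transcendence degree 7. -/

import Mathlib

set_option synthInstance.maxHeartbeats 1000000
set_option maxHeartbeats 1000000
noncomputable section
open MvPolynomial

/-- The field of invariant rational functions: the subfield of the fraction field of `R`
consisting of elements fixed by a family of `ℂ`-algebra endomorphisms of `R`. -/
def invariantField (R : Type*) [CommRing R] [IsDomain R] [Algebra ℂ R]
    {ι : Type*} (φ : ι → (R →ₐ[ℂ] R)) : IntermediateField ℂ (FractionRing R) where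
  carrier := {x | ∃ f g : R, g ≠ 0 ∧
      x = algebraMap R (FractionRing R) f / algebraMap R (FractionRing R) g ∧
      ∀ i, φ i f * g = φ i g * f}
  mul_mem' := by
    rintro x y ⟨f, g, hg, rfl, hf⟩ ⟨p, q, hq, rfl, hp⟩
    exact ⟨f * p, g * q, mul_ne_zero hg hq,
      by rw [map_mul, map_mul, div_mul_div_comm],
      fun i => by
        simp only [map_mul]
        linear_combination (φ i p * q) * hf i + (φ i g * f) * hp i⟩
  one_mem' := ⟨1, 1, one_ne_zero, by simp, fun i => rfl⟩
  add_mem' := by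
    rintro x y ⟨f, g, hg, rfl, hf⟩ ⟨p, q, hq, rfl, hp⟩
    have hg' : algebraMap R (FractionRing R) g ≠ 0 :=
      fun h => hg ((map_eq_zero_iff _ (IsFractionRing.injective R (FractionRing R))).mp h)
    have hq' : algebraMap R (FractionRing R) q ≠ 0 :=
      fun h => hq ((map_eq_zero_iff _ (IsFractionRing.injective R (FractionRing R))).mp h)
    refine ⟨f * q + g * p, g * q, mul_ne_zero hg hq, ?_, fun i => ?_⟩
    · rw [map_add, map_mul, map_mul, map_mul, div_add_div _ _ hg' hq']
    · simp only [map_add, map_mul]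
      linear_combination (φ i q * q) * hf i + (φ i g * g) * hp i
  zero_mem' := ⟨0, 1, one_ne_zero, by simp, fun i => by simp⟩
  algebraMap_mem' := fun c =>
    ⟨algebraMap ℂ R c, 1, one_ne_zero,
      by rw [map_one, div_one, ← IsScalarTower.algebraMap_apply],
      fun i => by simp [AlgHom.commutes]⟩
  inv_mem' := by
    rintro x ⟨f, g, hg, rfl, hf⟩
    by_cases hf0 : f = 0
    · exact ⟨0, 1, one_ne_zero, by simp [hf0], fun i => by simp⟩
    · exact ⟨g, f, hf0, by rw [inv_div], fun i => (hf i).symm⟩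

abbrev SL2 := Matrix.SpecialLinearGroup (Fin 2) ℂ

/-- The action of `SL₂(ℂ)` on binary forms by linear substitution of the variables. -/
def sub1 (g : SL2) : MvPolynomial (Fin 2) ℂ →ₐ[ℂ] MvPolynomial (Fin 2) ℂ :=
  aeval fun i => ∑ j, C (g.1 i j) * X j

/-- The matrix of the action of `g` on `V_d` in the basis of monomials `X^i Y^(d-i)`. -/
def repMat (d : ℕ) (g : SL2) (i j : Fin (d + 1)) : ℂ :=
  coeff (Finsupp.single 0 (i : ℕ) + Finsupp.single 1 (d - (i : ℕ)))
    (sub1 g (X 0 ^ (j : ℕ) * X 1 ^ (d - (j : ℕ))))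

/-- The endomorphism of the coordinate ring of `V_{a,b} = V_a ⊗ V_b` induced by
`(g, h) ∈ SL₂ × SL₂` together with the scaling by `t` (so that invariance under the
scalings expresses that a rational function descends to the projectivization). -/
def coordHomAB (a b : ℕ) (g h : SL2) (t : ℂˣ) :
    MvPolynomial (Fin (a + 1) × Fin (b + 1)) ℂ →ₐ[ℂ]
      MvPolynomial (Fin (a + 1) × Fin (b + 1)) ℂ :=
  aeval fun p => (t : ℂ) • ∑ q, C (repMat a g p.1 q.1 * repMat b h p.2 q.2) * X q

/-- The field `ℂ(P(V_{a,b}))^{SL₂×SL₂}` of `SL₂(ℂ) × SL₂(ℂ)`-invariant rational functions on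
the projective space of biforms of bidegree `(a,b)`, realized as the field of rational
functions in the coefficient coordinates (indexed by `Fin (a+1) × Fin (b+1)`) that are
invariant under the induced linear action and under scaling. -/
def invFieldAB (a b : ℕ) :
    IntermediateField ℂ (FractionRing (MvPolynomial (Fin (a + 1) × Fin (b + 1)) ℂ)) :=
  invariantField _ fun γ : SL2 × SL2 × ℂˣ => coordHomAB a b γ.1 γ.2.1 γ.2.2



abbrev M2 (R : Type*) := Matrix (Fin 2) (Fin 2) R
abbrev Idx := Fin (1 + 1) × Fin (6 + 1)

def linT {R : Type*} [CommRing R] (a b : R) : Polynomial R :=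
  Polynomial.C a * Polynomial.X + Polynomial.C b

def rep {R : Type*} [CommRing R] (d : ℕ) (h : M2 R) (k j : Fin (d + 1)) : R :=
  (linT (h 0 0) (h 0 1) ^ (j : ℕ) * linT (h 1 0) (h 1 1) ^ (d - (j : ℕ))).coeff k

def act {R : Type*} [CommRing R] (m h : M2 R) (x : Idx → R) : Idx → R :=
  fun p => ∑ i : Fin 2, ∑ j : Fin (6 + 1), m p.1 i * rep 6 h p.2 j * x (i, j)

theorem rep_map {R S : Type*} [CommRing R] [CommRing S] (f : R →+* S) (d : ℕ) (h : M2 R)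
    (k j : Fin (d + 1)) : f (rep d h k j) = rep d (h.map f) k j := by
  simp only [rep, linT, ← Polynomial.coeff_map, Polynomial.map_mul, Polynomial.map_pow,
    Polynomial.map_add, Polynomial.map_C, Polynomial.map_X, Matrix.map_apply]

theorem act_map {R S : Type*} [CommRing R] [CommRing S] (f : R →+* S) (m h : M2 R)
    (x : Idx → R) (p : Idx) : f (act m h x p) = act (m.map f) (h.map f) (f ∘ x) p := by
  simp only [act, map_sum, map_mul, rep_map, Matrix.map_apply, Function.comp]

theorem natDegree_linT_pow {R : Type*} [CommRing R] (a b : R) (n : ℕ) :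
    (linT a b ^ n).natDegree ≤ n := by
  refine (Polynomial.natDegree_pow_le).trans ?_
  have : (linT a b).natDegree ≤ 1 := Polynomial.natDegree_linear_le
  nlinarith

theorem homog_eval {R : Type*} [CommRing R] (p : Polynomial R) (d : ℕ) :
    p.homogenize d = ∑ k : Fin (d + 1), C (p.coeff k) * X 0 ^ (k : ℕ) * X 1 ^ (d - (k : ℕ)) := by
  rw [Polynomial.homogenize, Finset.Nat.sum_antidiagonal_eq_sum_range_succ_mk, Finset.sum_range]
  refine Finset.sum_congr rfl fun k _ => ?_
  rw [MvPolynomial.monomial_eq]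
  simp [Finsupp.prod_fintype, mul_assoc]

theorem homog_lin_pow {R : Type*} [CommRing R] (a b : R) (n : ℕ) :
    (linT a b ^ n).homogenize n = (C a * X 0 + C b * X 1) ^ n := by
  have h1 : (linT a b).homogenize 1 = C a * X 0 + C b * X 1 := by
    rw [linT, Polynomial.homogenize_add, Polynomial.homogenize_C_mul,
      Polynomial.homogenize_X one_ne_zero, Polynomial.homogenize_C]; simp
  induction n with
  | zero => simp
  | succ n ih =>
    rw [pow_succ, pow_succ, Polynomial.homogenize_mul _ _ (natDegree_linT_pow a b n)
      (show (linT a b).natDegree ≤ 1 from Polynomial.natDegree_linear_le), ih, h1]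

theorem rep_mv {R : Type*} [CommRing R] (d : ℕ) (h : M2 R) (j : Fin (d + 1)) :
    ∑ k : Fin (d + 1), C (rep d h k j) * (X 0 : MvPolynomial (Fin 2) R) ^ (k : ℕ) *
      X 1 ^ (d - (k : ℕ)) =
    (C (h 0 0) * X 0 + C (h 0 1) * X 1) ^ (j : ℕ) *
      (C (h 1 0) * X 0 + C (h 1 1) * X 1) ^ (d - (j : ℕ)) := by
  unfold rep
  rw [← homog_eval, ← homog_lin_pow, ← homog_lin_pow,
    ← Polynomial.homogenize_mul _ _ (natDegree_linT_pow _ _ _) (natDegree_linT_pow _ _ _)]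
  congr 1
  have := j.2
  omega

theorem rep_eval {R S : Type*} [CommRing R] [CommRing S] (f : R →+* S) (d : ℕ) (h : M2 R)
    (j : Fin (d + 1)) (s t : S) :
    ∑ k : Fin (d + 1), f (rep d h k j) * s ^ (k : ℕ) * t ^ (d - (k : ℕ)) =
    (f (h 0 0) * s + f (h 0 1) * t) ^ (j : ℕ) *
      (f (h 1 0) * s + f (h 1 1) * t) ^ (d - (j : ℕ)) := by
  have := congrArg (eval₂Hom f ![s, t]) (rep_mv d h j)
  simpa using this

theorem rep_mul {R : Type*} [CommRing R] (d : ℕ) (h h' : M2 R) (k j : Fin (d + 1)) :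
    rep d (h' * h) k j = ∑ l, rep d h k l * rep d h' l j := by
  have e := rep_eval (Polynomial.C) d h' j (linT (h 0 0) (h 0 1)) (linT (h 1 0) (h 1 1))
  have e1 : ∀ i : Fin 2, linT ((h' * h) i 0) ((h' * h) i 1) =
      Polynomial.C (h' i 0) * linT (h 0 0) (h 0 1) +
      Polynomial.C (h' i 1) * linT (h 1 0) (h 1 1) := by
    intro i
    simp only [Matrix.mul_apply, Fin.sum_univ_two, linT, map_add, map_mul]
    ring
  rw [rep, e1, e1, ← e, Polynomial.finsetSum_coeff]
  refine Finset.sum_congr rfl fun l _ => ?_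
  rw [mul_assoc, Polynomial.coeff_C_mul, mul_comm]
  rfl

theorem act_act {R : Type*} [CommRing R] (m h m' h' : M2 R) (x : Idx → R) :
    act m h (act m' h' x) = act (m * m') (h' * h) x := by
  funext p
  simp only [act, rep_mul, Matrix.mul_apply, Finset.mul_sum, Finset.sum_mul]
  calc _ = ∑ i : Fin 2, ∑ i' : Fin 2, ∑ j : Fin (6+1), ∑ j' : Fin (6+1),
      m p.1 i * rep 6 h p.2 j * (m' i i' * rep 6 h' j j' * x (i', j')) := by
        refine Finset.sum_congr rfl fun i _ => ?_
        rw [Finset.sum_comm]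
    _ = ∑ i' : Fin 2, ∑ i : Fin 2, ∑ j' : Fin (6+1), ∑ j : Fin (6+1),
      m p.1 i * rep 6 h p.2 j * (m' i i' * rep 6 h' j j' * x (i', j')) := by
        rw [Finset.sum_comm]
        refine Finset.sum_congr rfl fun i _ => ?_
        refine Finset.sum_congr rfl fun i _ => ?_
        rw [Finset.sum_comm]
    _ = _ := by
        refine Finset.sum_congr rfl fun i _ => ?_
        rw [Finset.sum_comm]
        refine Finset.sum_congr rfl fun j _ => ?_
        rw [Finset.sum_comm]
        refine Finset.sum_congr rfl fun i' _ => ?_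
        refine Finset.sum_congr rfl fun j' _ => ?_
        ring

theorem rep_diag {R : Type*} [CommRing R] (d : ℕ) (a b : R) (k j : Fin (d + 1)) :
    rep d !![a, 0; 0, b] k j = if k = j then a ^ (j : ℕ) * b ^ (d - (j : ℕ)) else 0 := by
  simp only [rep, linT]
  simp only [Matrix.of_apply, Matrix.cons_val', Matrix.cons_val_zero, Matrix.cons_val_one,
    Matrix.cons_val_fin_one, map_zero, add_zero, zero_mul, zero_add, mul_pow, ← Polynomial.C_pow]
  rw [mul_assoc, mul_comm (Polynomial.X ^ _), ← mul_assoc, ← Polynomial.C_mul,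
    Polynomial.coeff_C_mul, Polynomial.coeff_X_pow]
  simp [Fin.ext_iff]

theorem rep_anti {R : Type*} [CommRing R] (d : ℕ) (a b : R) (k j : Fin (d + 1)) :
    rep d !![0, a; b, 0] k j = if (k : ℕ) = d - j then a ^ (j : ℕ) * b ^ (d - (j : ℕ)) else 0 := by
  simp only [rep, linT]
  simp only [Matrix.of_apply, Matrix.cons_val', Matrix.cons_val_zero, Matrix.cons_val_one,
    Matrix.cons_val_fin_one, map_zero, add_zero, zero_mul, zero_add, mul_pow, ← Polynomial.C_pow]
  rw [← mul_assoc, ← Polynomial.C_mul,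
    Polynomial.coeff_C_mul, Polynomial.coeff_X_pow]
  simp

theorem rep_upper {R : Type*} [CommRing R] (d : ℕ) (z : R) (k j : Fin (d + 1)) :
    rep d !![1, z; 0, 1] k j = z ^ ((j : ℕ) - k) * ((j : ℕ).choose k) := by
  simp only [rep, linT]
  simp [Polynomial.coeff_X_add_C_pow]

theorem act_one {R : Type*} [CommRing R] (x : Idx → R) : act 1 1 x = x := by
  funext p
  have : (1 : M2 R) = !![1, 0; 0, 1] := Matrix.one_fin_two
  rw [act]
  conv_lhs => enter [2, i, 2, j]; rw [this, rep_diag, ← this]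
  simp [Matrix.one_apply]

/-- equivalence -/
def GRel {R : Type*} [CommRing R] (x y : Idx → R) : Prop :=
  ∃ m h : M2 R, IsUnit m.det ∧ h.det = 1 ∧ y = act m h x

theorem GRel.trans {R : Type*} [CommRing R] {x y z : Idx → R} (h1 : GRel x y) (h2 : GRel y z) :
    GRel x z := by
  obtain ⟨m, h, hm, hh, rfl⟩ := h1
  obtain ⟨m', h', hm', hh', rfl⟩ := h2
  exact ⟨m' * m, h * h', by rw [Matrix.det_mul]; exact hm'.mul hm, by rw [Matrix.det_mul, hh, hh', one_mul],
    act_act _ _ _ _ _⟩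

theorem act_inv {R : Type*} [CommRing R] {m h : M2 R} (hm : IsUnit m.det) (hh : h.det = 1)
    (x : Idx → R) : act m⁻¹ h.adjugate (act m h x) = x := by
  rw [act_act, Matrix.nonsing_inv_mul _ hm, Matrix.mul_adjugate, hh, one_smul, act_one]

theorem GRel.symm {R : Type*} [CommRing R] {x y : Idx → R} (h1 : GRel x y) : GRel y x := by
  obtain ⟨m, h, hm, hh, rfl⟩ := h1
  refine ⟨m⁻¹, h.adjugate, (Matrix.isUnit_nonsing_inv_det _ hm), ?_, (act_inv hm hh x).symm⟩
  rw [Matrix.det_adjugate, hh, one_pow]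

theorem GRel.map {R S : Type*} [CommRing R] [CommRing S] (f : R →+* S) {x y : Idx → R}
    (h1 : GRel x y) : GRel (f ∘ x) (f ∘ y) := by
  obtain ⟨m, h, hm, hh, rfl⟩ := h1
  refine ⟨m.map f, h.map f, ?_, ?_, ?_⟩
  · have := hm.map f
    rwa [RingHom.map_det] at this
  · have := congrArg f hh
    rwa [RingHom.map_det, map_one] at this
  · funext p
    exact act_map f m h x p

theorem repMat_eq (d : ℕ) (g : SL2) (i j : Fin (d + 1)) : repMat d g i j = rep d g.1 i j := by
  have e : sub1 g (X 0 ^ (j : ℕ) * X 1 ^ (d - (j : ℕ))) =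
      ∑ k : Fin (d + 1), C (rep d g.1 k j) * (X 0 : MvPolynomial (Fin 2) ℂ) ^ (k : ℕ) *
      X 1 ^ (d - (k : ℕ)) := by
    rw [sub1, map_mul, map_pow, map_pow, aeval_X, aeval_X, Fin.sum_univ_two, Fin.sum_univ_two,
      rep_mv]
  rw [repMat, e, coeff_sum, Finset.sum_eq_single i]
  · rw [X_pow_eq_monomial, X_pow_eq_monomial, mul_assoc, monomial_mul, coeff_C_mul, coeff_monomial]
    simp
  · intro k _ hk
    rw [X_pow_eq_monomial, X_pow_eq_monomial, mul_assoc, monomial_mul, coeff_C_mul, coeff_monomial,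
      if_neg, mul_zero]
    intro h
    have := DFunLike.congr_fun h 0
    simp at this
    exact hk (Fin.ext this)
  · simp

/-- the flipped matrix -/
def flip2 {R : Type*} (g : M2 R) : M2 R := !![g 1 1, g 0 1; g 1 0, g 0 0]

theorem rep_one_eq {R : Type*} [CommRing R] (g : M2 R) (i j : Fin 2) :
    rep 1 g i j = flip2 g i j := by
  simp only [rep, linT, flip2]
  fin_cases i <;> fin_cases j <;> simp

theorem aeval_coordHom {S : Type*} [CommRing S] [Algebra ℂ S] (g h : SL2) (t : ℂˣ)
    (n : MvPolynomial Idx ℂ) (x : Idx → S) :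
    aeval x (coordHomAB 1 6 g h t n) =
      aeval (act (((t : ℂ) • flip2 g.1).map (algebraMap ℂ S)) (h.1.map (algebraMap ℂ S)) x) n := by
  have : (aeval x).comp (coordHomAB 1 6 g h t) =
      aeval (act (((t : ℂ) • flip2 g.1).map (algebraMap ℂ S)) (h.1.map (algebraMap ℂ S)) x) := by
    apply MvPolynomial.algHom_ext
    intro p
    simp only [AlgHom.comp_apply, coordHomAB, aeval_X, act, map_smul, map_sum, map_mul, aeval_C,
      repMat_eq]
    rw [Fintype.sum_prod_type, Finset.smul_sum]
    refine Finset.sum_congr rfl fun i _ => ?_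
    rw [Finset.smul_sum]
    refine Finset.sum_congr rfl fun j _ => ?_
    rw [Algebra.smul_def, ← rep_map, rep_one_eq]
    simp only [aeval_C, Matrix.map_apply, Matrix.smul_apply, smul_eq_mul, map_mul]
    ring
  exact DFunLike.congr_fun this n


section
variable {K : Type*} [Field K]

def q2 {R : Type*} [CommRing R] (x : Idx → R) : R :=
  15 * (x (0,6) * x (1,1) - x (0,1) * x (1,6)) - 5 * (x (0,5) * x (1,2) - x (0,2) * x (1,5)) +
    3 * (x (0,4) * x (1,3) - x (0,3) * x (1,4))
def q1 {R : Type*} [CommRing R] (x : Idx → R) : R :=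
  90 * (x (0,6) * x (1,0) - x (0,0) * x (1,6)) - 10 * (x (0,5) * x (1,1) - x (0,1) * x (1,5)) +
    2 * (x (0,4) * x (1,2) - x (0,2) * x (1,4))
def q0 {R : Type*} [CommRing R] (x : Idx → R) : R :=
  15 * (x (0,5) * x (1,0) - x (0,0) * x (1,5)) - 5 * (x (0,4) * x (1,1) - x (0,1) * x (1,4)) +
    3 * (x (0,3) * x (1,2) - x (0,2) * x (1,3))

def QEq (m h : M2 K) : Prop := ∀ x : Idx → K,
  q2 (act m h x) = m.det * (q2 x * h 0 0 ^ 2 + q1 x * h 0 0 * h 1 0 + q0 x * h 1 0 ^ 2) ∧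
  q1 (act m h x) = m.det * (2 * q2 x * h 0 0 * h 0 1 + q1 x * (h 0 0 * h 1 1 + h 0 1 * h 1 0) +
    2 * q0 x * h 1 0 * h 1 1) ∧
  q0 (act m h x) = m.det * (q2 x * h 0 1 ^ 2 + q1 x * h 0 1 * h 1 1 + q0 x * h 1 1 ^ 2)

theorem QEq.mul {m h m' h' : M2 K} (e : QEq m h) (e' : QEq m' h') : QEq (m * m') (h' * h) := by
  intro x
  obtain ⟨a1, a2, a3⟩ := e (act m' h' x)
  obtain ⟨b1, b2, b3⟩ := e' x
  rw [act_act] at a1 a2 a3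
  simp only [a1, a2, a3, b1, b2, b3, Matrix.det_mul, Matrix.mul_apply, Fin.sum_univ_two]
  refine ⟨?_, ?_, ?_⟩ <;> ring

theorem sum7 {R : Type*} [AddCommMonoid R] (f : Fin (6 + 1) → R) : ∑ i, f i =
    f 0 + f 1 + f 2 + f 3 + f 4 + f 5 + f 6 := Fin.sum_univ_seven f

theorem act_diag {R : Type*} [CommRing R] (m : M2 R) (a b : R) (x : Idx → R) (i : Fin (1 + 1))
    (k : Fin (6 + 1)) :
    act m !![a, 0; 0, b] x (i, k) =
      a ^ (k : ℕ) * b ^ (6 - (k : ℕ)) * (m i 0 * x (0, k) + m i 1 * x (1, k)) := by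
  simp only [act, rep_diag, Fin.sum_univ_two]
  simp
  ring

theorem act_anti {R : Type*} [CommRing R] (m : M2 R) (a b : R) (x : Idx → R) (i : Fin (1 + 1))
    (k : Fin (6 + 1)) :
    act m !![0, a; b, 0] x (i, k) =
      a ^ (6 - (k : ℕ)) * b ^ (k : ℕ) * (m i 0 * x (0, k.rev) + m i 1 * x (1, k.rev)) := by
  have : ∀ j : Fin (6 + 1), ((k : ℕ) = 6 - (j : ℕ)) ↔ (k.rev = j) := by
    intro j
    rw [Fin.ext_iff, Fin.val_rev]
    have := k.2
    have := j.2
    omega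
  simp only [act, rep_anti, Fin.sum_univ_two, this]
  have h1 : 6 - (6 - (k : ℕ)) = k := by have := k.2; omega
  simp [Fin.val_rev, h1]
  ring

theorem QEq_diag (m : M2 K) (a b : K) (hab : a * b = 1) : QEq m !![a, 0; 0, b] := by
  intro x
  simp only [q2, q1, q0, act_diag, Matrix.det_fin_two]
  simp
  have hb : b = a⁻¹ := eq_inv_of_mul_eq_one_right hab
  have ha : a ≠ 0 := left_ne_zero_of_mul_eq_one hab
  subst hb
  refine ⟨?_, ?_, ?_⟩ <;> field_simp <;> ring

theorem QEq_anti (m : M2 K) (a b : K) (hab : a * b = -1) : QEq m !![0, a; b, 0] := by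
  intro x
  simp only [q2, q1, q0, act_anti, Matrix.det_fin_two]
  have r : (Fin.rev (0 : Fin (6+1)) = 6) ∧ (Fin.rev (1 : Fin (6+1)) = 5) ∧ (Fin.rev (2 : Fin (6+1)) = 4) ∧
    (Fin.rev (3 : Fin (6+1)) = 3) ∧ (Fin.rev (4 : Fin (6+1)) = 2) ∧ (Fin.rev (5 : Fin (6+1)) = 1) ∧
    (Fin.rev (6 : Fin (6+1)) = 0) := by decide
  obtain ⟨r0, r1, r2, r3, r4, r5, r6⟩ := r
  rw [r0, r1, r2, r3, r4, r5, r6]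
  have hb0 : b ≠ 0 := by rintro rfl; simp at hab
  have ha : a = -b⁻¹ := by field_simp; linear_combination hab
  subst ha
  simp
  refine ⟨?_, ?_, ?_⟩ <;> field_simp <;> ring

theorem QEq_upper (z : K) : QEq 1 !![1, z; 0, 1] := by
  intro x
  simp only [q2, q1, q0, act, rep_upper, Matrix.det_one, sum7, Fin.sum_univ_two]
  simp [Nat.choose]
  refine ⟨?_, ?_, ?_⟩ <;> ring

theorem QEq_all (m h : M2 K) (hh : h.det = 1) : QEq m h := by
  rw [Matrix.det_fin_two] at hh
  by_cases hc : h 1 0 = 0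
  · have ha : h 0 0 ≠ 0 := by rintro h0; simp [h0, hc] at hh
    have had : h 0 0 * h 1 1 = 1 := by simpa [hc] using hh
    have e := (QEq_upper (h 0 1 / h 0 0)).mul (QEq_diag m _ _ had)
    have e2 : !![h 0 0, 0; 0, h 1 1] * !![1, h 0 1 / h 0 0; 0, 1] = h := by
      ext i j
      fin_cases i <;> fin_cases j <;> simp [Matrix.mul_apply, hc]
      field_simp
    rwa [e2, one_mul] at e
  · have e := ((QEq_upper (h 1 1 / h 1 0)).mul (QEq_anti m (-1 / h 1 0) (h 1 0)
      (by field_simp))).mul (QEq_upper (h 0 0 / h 1 0))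
    have e2 : !![1, h 0 0 / h 1 0; 0, 1] * (!![0, -1 / h 1 0; h 1 0, 0] *
        !![1, h 1 1 / h 1 0; 0, 1]) = h := by
      ext i j
      fin_cases i <;> fin_cases j <;> simp [Matrix.mul_apply, Fin.sum_univ_two] <;> field_simp
      linear_combination hh
    rwa [e2, one_mul, mul_one] at e

end


section
variable {K : Type*} [Field K]

/-- the slice; `u = (c, d, C, D, A, B, δ)` -/
def sl (u : Fin 7 → K) : Idx → K := fun p =>
  (![![(3 + 15 * (u 4 + u 5) * (u 2 - u 3) + 5 * (u 4 - u 5) - 5 * u 6 * (u 0 - u 1)) /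
        (15 * (u 0 + u 1)), u 4 - u 5, - u 6, 1, u 6, u 4 + u 5,
      (3 + 15 * (u 4 - u 5) * (u 2 + u 3) + 5 * (u 4 + u 5) + 5 * u 6 * (u 0 + u 1)) /
        (15 * (u 0 - u 1))],
    ![u 2 - u 3, u 0 - u 1, 1, 0, 1, u 0 + u 1, u 2 + u 3]] p.1) p.2

def wf (u : Fin 7 → K) : Fin 7 → K :=
  ![u 2, u 3 ^ 2, u 0 ^ 2, u 0 * u 1 * u 3, u 4, u 5 * u 3, u 6 * u 0 * u 3]

def good (u : Fin 7 → K) : Prop :=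
  u 0 ≠ 0 ∧ u 3 ≠ 0 ∧ u 0 + u 1 ≠ 0 ∧ u 0 - u 1 ≠ 0 ∧ q1 (sl u) ≠ 0

theorem sl_map {K' : Type*} [Field K'] (f : K →+* K') (u : Fin 7 → K) :
    sl (f ∘ u) = f ∘ sl u := by
  funext ⟨i, j⟩
  fin_cases i <;> fin_cases j <;> simp [sl, map_ofNat]

theorem wf_map {K' : Type*} [Field K'] (f : K →+* K') (u : Fin 7 → K) :
    wf (f ∘ u) = f ∘ wf u := by
  funext i
  fin_cases i <;> simp [wf]

theorem q1_map {R S : Type*} [CommRing R] [CommRing S] (f : R →+* S) (x : Idx → R) :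
    q1 (f ∘ x) = f (q1 x) := by
  simp [q1, map_ofNat]

theorem good_map {K' : Type*} [Field K'] (f : K →+* K') (u : Fin 7 → K) (h : good u) :
    good (f ∘ u) := by
  obtain ⟨h1, h2, h3, h4, h5⟩ := h
  refine ⟨?_, ?_, ?_, ?_, ?_⟩
  · simpa using h1
  · simpa using h2
  · simpa [← map_add] using h3
  · simpa [← map_sub] using h4
  · rw [sl_map, q1_map]
    simpa using h5

theorem sl_q2 [CharZero K] (u : Fin 7 → K) (h : u 0 - u 1 ≠ 0) : q2 (sl u) = 0 := by
  have e : q2 (sl u) = 15 * ((3 + 15 * (u 4 - u 5) * (u 2 + u 3) + 5 * (u 4 + u 5) + 5 * u 6 * (u 0 + u 1)) /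
        (15 * (u 0 - u 1)) * (u 0 - u 1) - (u 4 - u 5) * (u 2 + u 3)) - 5 * ((u 4 + u 5) * 1 - (- u 6) * (u 0 + u 1))
        + 3 * (u 6 * 0 - 1 * 1) := rfl
  rw [e]
  field_simp
  ring

theorem sl_q0 [CharZero K] (u : Fin 7 → K) (h : u 0 + u 1 ≠ 0) : q0 (sl u) = 0 := by
  have e : q0 (sl u) = 15 * ((u 4 + u 5) * (u 2 - u 3) -
    (3 + 15 * (u 4 + u 5) * (u 2 - u 3) + 5 * (u 4 - u 5) - 5 * u 6 * (u 0 - u 1)) /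
        (15 * (u 0 + u 1)) * (u 0 + u 1)) - 5 * (u 6 * (u 0 - u 1) - (u 4 - u 5) * 1)
        + 3 * (1 * 1 - (- u 6) * 0) := rfl
  rw [e]
  field_simp
  ring

theorem rev7 : (Fin.rev (0 : Fin (6+1)) = 6) ∧ (Fin.rev (1 : Fin (6+1)) = 5) ∧ (Fin.rev (2 : Fin (6+1)) = 4) ∧
    (Fin.rev (3 : Fin (6+1)) = 3) ∧ (Fin.rev (4 : Fin (6+1)) = 2) ∧ (Fin.rev (5 : Fin (6+1)) = 1) ∧
    (Fin.rev (6 : Fin (6+1)) = 0) := by decide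

theorem slv (u : Fin 7 → K) : sl u (0,1) = u 4 - u 5 ∧ sl u (0,2) = - u 6 ∧ sl u (0,3) = 1 ∧
  sl u (0,4) = u 6 ∧ sl u (0,5) = u 4 + u 5 ∧ sl u (1,0) = u 2 - u 3 ∧ sl u (1,1) = u 0 - u 1 ∧
  sl u (1,2) = 1 ∧ sl u (1,3) = 0 ∧ sl u (1,4) = 1 ∧ sl u (1,5) = u 0 + u 1 ∧
  sl u (1,6) = u 2 + u 3 := ⟨rfl, rfl, rfl, rfl, rfl, rfl, rfl, rfl, rfl, rfl, rfl, rfl⟩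

theorem claimU [CharZero K] (u u' : Fin 7 → K) (hu : good u) (hu' : good u')
    (hr : GRel (sl u) (sl u')) : wf u' = wf u := by
  obtain ⟨m, h, hm, hh, he⟩ := hr
  obtain ⟨-, -, g3, g4, g5⟩ := hu
  obtain ⟨-, -, k3, k4, -⟩ := hu'
  obtain ⟨e2, -, e0⟩ := QEq_all m h hh (sl u)
  rw [← he, sl_q2 _ k4, sl_q2 _ g4, sl_q0 _ g3] at e2
  rw [← he, sl_q0 _ k3, sl_q2 _ g4, sl_q0 _ g3] at e0
  have hm0 := hm.ne_zero
  have f1 : h 0 0 * h 1 0 = 0 := by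
    have : m.det * (q1 (sl u)) * (h 0 0 * h 1 0) = 0 := by linear_combination -e2
    exact (mul_eq_zero.mp this).resolve_left (mul_ne_zero hm0 g5)
  have f2 : h 0 1 * h 1 1 = 0 := by
    have : m.det * (q1 (sl u)) * (h 0 1 * h 1 1) = 0 := by linear_combination -e0
    exact (mul_eq_zero.mp this).resolve_left (mul_ne_zero hm0 g5)
  rw [Matrix.det_fin_two] at hh
  obtain ⟨s1, s2, s3, s4, s5, s6, s7, s8, s9, s10, s11, s12⟩ := slv u
  obtain ⟨t1, t2, t3, t4, t5, t6, t7, t8, t9, t10, t11, t12⟩ := slv u'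
  have two : (2 : K) ≠ 0 := two_ne_zero
  rcases mul_eq_zero.mp f1 with ha | hc
  · -- antidiagonal
    have hbc : h 0 1 * h 1 0 = -1 := by linear_combination -hh + h 1 1 * ha
    have hd : h 1 1 = 0 := by
      rcases mul_eq_zero.mp f2 with hb | hd
      · rw [hb] at hbc; simp at hbc
      · exact hd
    have hH : h = !![0, h 0 1; h 1 0, 0] := by
      ext i j
      fin_cases i <;> fin_cases j <;> simp [ha, hd]
    generalize h 0 1 = b at *
    generalize h 1 0 = c at *
    subst hH
    have key : ∀ i k, sl u' (i, k) = _ := fun i k => (congrFun he (i, k)).trans (act_anti m b c (sl u) i k)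
    obtain ⟨r0, r1, r2, r3, r4, r5, r6⟩ := rev7
    have a1 := key 0 1
    have a2 := key 0 2
    have a3 := key 0 3
    have a4 := key 0 4
    have a5 := key 0 5
    have b0 := key 1 0
    have b1 := key 1 1
    have b2 := key 1 2
    have b3 := key 1 3
    have b4 := key 1 4
    have b5 := key 1 5
    have b6 := key 1 6
    rw [t1, r1, s5, s11] at a1
    rw [t2, r2, s4, s10] at a2
    rw [t3, r3, s3, s9] at a3
    rw [t4, r4, s2, s8] at a4
    rw [t5, r5, s1, s7] at a5
    rw [t6, r0] at b0
    rw [t7, r1, s5, s11] at b1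
    rw [t8, r2, s4, s10] at b2
    rw [t9, r3, s3, s9] at b3
    rw [t10, r4, s2, s8] at b4
    rw [t11, r5, s1, s7] at b5
    rw [t12, r6] at b6
    have p1 : b ^ 6 = (b ^ 2) ^ 3 := by ring
    have p2 : b ^ 5 * c = - (b ^ 2) ^ 2 := by linear_combination b ^ 4 * hbc
    have p3 : b ^ 4 * c ^ 2 = b ^ 2 := by linear_combination b ^ 2 * (b * c - 1) * hbc
    have p4 : b ^ 3 * c ^ 3 = -1 := by rw [← mul_pow, hbc]; ring
    have p5 : b ^ 2 * c ^ 4 = c ^ 2 := by linear_combination c ^ 2 * (b * c - 1) * hbc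
    have p6 : b * c ^ 5 = - (c ^ 2) ^ 2 := by linear_combination c ^ 4 * hbc
    have p7 : c ^ 6 = (c ^ 2) ^ 3 := by ring
    have p8 : b ^ 2 * c ^ 2 = 1 := by linear_combination (b * c - 1) * hbc
    simp only [Fin.coe_ofNat_eq_mod, Nat.reduceMod, Nat.reduceSub, Nat.reduceAdd, pow_zero, pow_one,
      one_mul, mul_one, p1, p2, p3, p4, p5, p6, p7] at a1 a2 a3 a4 a5 b0 b1 b2 b3 b4 b5 b6
    have m10 : m 1 0 = 0 := by linear_combination b3
    have m00 : m 0 0 = -1 := by linear_combination a3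
    rw [m10] at b0 b1 b2 b4 b5 b6
    rw [m00] at a1 a2 a4 a5
    have e1 : m 1 1 = c ^ 2 := by linear_combination - c ^ 2 * b2 - m 1 1 * p8
    have e2 : m 1 1 = b ^ 2 := by linear_combination - b ^ 2 * b4 - m 1 1 * p8
    rw [← e1, ← e2] at p8
    rw [← e1] at a4 a5 b4 b5 b6
    rw [← e2] at a1 a2 b0 b1 b2
    rw [s12] at b0
    rw [s6] at b6
    generalize m 1 1 = e at *
    have m01 : m 0 1 = 0 := by
      have : 2 * m 0 1 = 0 := by linear_combination -e * a2 - e * a4 - 2 * m 0 1 * p8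
      simpa using this
    rw [m01] at a1 a2 a4 a5
    have v6 : u' 6 = e * u 6 := by linear_combination a4
    have v4 : u' 4 = u 4 := mul_left_cancel₀ two (by linear_combination a1 + a5 + 2 * u 4 * p8)
    have v5 : u' 5 = - u 5 := mul_left_cancel₀ two (by linear_combination a5 - a1 - 2 * u 5 * p8)
    have v2 : u' 2 = u 2 := mul_left_cancel₀ two (by linear_combination b0 + b6 + 2 * (e * e + 1) * u 2 * p8)
    have v3 : u' 3 = - u 3 := mul_left_cancel₀ two (by linear_combination b6 - b0 - 2 * (e * e + 1) * u 3 * p8)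
    have v0 : u' 0 = - e * u 0 := mul_left_cancel₀ two (by linear_combination b1 + b5 - 2 * e * u 0 * p8)
    have v1 : u' 1 = e * u 1 := mul_left_cancel₀ two (by linear_combination b5 - b1 + 2 * e * u 1 * p8)
    funext i
    fin_cases i <;> simp only [wf, v0, v1, v2, v3, v4, v5, v6] <;> simp
    · linear_combination u 0 ^ 2 * p8
    · left; linear_combination u 0 * u 1 * p8
    · left; linear_combination u 6 * u 0 * p8
  · have had : h 0 0 * h 1 1 = 1 := by linear_combination hh + h 0 1 * hc
    have hb : h 0 1 = 0 := by
      rcases mul_eq_zero.mp f2 with hb | hd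
      · exact hb
      · rw [hd] at had; simp at had
    have hH : h = !![h 0 0, 0; 0, h 1 1] := by
      ext i j
      fin_cases i <;> fin_cases j <;> simp [hb, hc]
    generalize h 0 0 = a at *
    generalize h 1 1 = d at *
    subst hH
    have key : ∀ i k, sl u' (i, k) = _ := fun i k => (congrFun he (i, k)).trans (act_diag m a d (sl u) i k)
    have a1 := key 0 1
    have a2 := key 0 2
    have a3 := key 0 3
    have a4 := key 0 4
    have a5 := key 0 5
    have b0 := key 1 0
    have b1 := key 1 1
    have b2 := key 1 2
    have b3 := key 1 3
    have b4 := key 1 4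
    have b5 := key 1 5
    have b6 := key 1 6
    rw [t1, s1, s7] at a1
    rw [t2, s2, s8] at a2
    rw [t3, s3, s9] at a3
    rw [t4, s4, s10] at a4
    rw [t5, s5, s11] at a5
    rw [t6, s6] at b0
    rw [t7, s1, s7] at b1
    rw [t8, s2, s8] at b2
    rw [t9, s3, s9] at b3
    rw [t10, s4, s10] at b4
    rw [t11, s5, s11] at b5
    rw [t12, s12] at b6
    have p1 : d ^ 6 = (d ^ 2) ^ 3 := by ring
    have p2 : a * d ^ 5 = (d ^ 2) ^ 2 := by linear_combination d ^ 4 * had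
    have p3 : a ^ 2 * d ^ 4 = d ^ 2 := by linear_combination d ^ 2 * (a * d + 1) * had
    have p4 : a ^ 3 * d ^ 3 = 1 := by rw [← mul_pow, had]; ring
    have p5 : a ^ 4 * d ^ 2 = a ^ 2 := by linear_combination a ^ 2 * (a * d + 1) * had
    have p6 : a ^ 5 * d = (a ^ 2) ^ 2 := by linear_combination a ^ 4 * had
    have p7 : a ^ 6 = (a ^ 2) ^ 3 := by ring
    have p8 : a ^ 2 * d ^ 2 = 1 := by linear_combination (a * d + 1) * had
    simp only [Fin.coe_ofNat_eq_mod, Nat.reduceMod, Nat.reduceSub, Nat.reduceAdd, pow_zero, pow_one,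
      one_mul, mul_one, p1, p2, p3, p4, p5, p6, p7] at a1 a2 a3 a4 a5 b0 b1 b2 b3 b4 b5 b6
    have m10 : m 1 0 = 0 := by linear_combination -b3
    have m00 : m 0 0 = 1 := by linear_combination -a3
    rw [m10] at b0 b1 b2 b4 b5 b6
    rw [m00] at a1 a2 a4 a5
    have e1 : m 1 1 = a ^ 2 := by linear_combination - a ^ 2 * b2 - m 1 1 * p8
    have e2 : m 1 1 = d ^ 2 := by linear_combination - d ^ 2 * b4 - m 1 1 * p8
    rw [← e1, ← e2] at p8
    rw [← e1] at a4 a5 b4 b5 b6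
    rw [← e2] at a1 a2 b0 b1 b2
    generalize m 1 1 = e at *
    have m01 : m 0 1 = 0 := by
      have : 2 * m 0 1 = 0 := by linear_combination -e * a2 - e * a4 - 2 * m 0 1 * p8
      simpa using this
    rw [m01] at a1 a2 a4 a5
    have v6 : u' 6 = e * u 6 := by linear_combination a4
    have v4 : u' 4 = u 4 := mul_left_cancel₀ two (by linear_combination a1 + a5 + 2 * u 4 * p8)
    have v5 : u' 5 = u 5 := mul_left_cancel₀ two (by linear_combination a5 - a1 + 2 * u 5 * p8)
    have v2 : u' 2 = u 2 := mul_left_cancel₀ two (by linear_combination b0 + b6 + 2 * (e * e + 1) * u 2 * p8)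
    have v3 : u' 3 = u 3 := mul_left_cancel₀ two (by linear_combination b6 - b0 + 2 * (e * e + 1) * u 3 * p8)
    have v0 : u' 0 = e * u 0 := mul_left_cancel₀ two (by linear_combination b1 + b5 + 2 * e * u 0 * p8)
    have v1 : u' 1 = e * u 1 := mul_left_cancel₀ two (by linear_combination b5 - b1 + 2 * e * u 1 * p8)
    funext i
    fin_cases i <;> simp only [wf, v0, v1, v2, v3, v4, v5, v6] <;> simp
    · linear_combination u 0 ^ 2 * p8
    · left; linear_combination u 0 * u 1 * p8
    · left; linear_combination u 6 * u 0 * p8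

theorem sgn1 [CharZero K] (I : K) (hI : I ^ 2 = -1) (u : Fin 7 → K) :
    GRel (sl u) (sl ![-u 0, -u 1, u 2, u 3, u 4, u 5, -u 6]) := by
  refine ⟨!![1, 0; 0, -1], !![I, 0; 0, -I], by simp, by simp; linear_combination -hI, ?_⟩
  have h3 : I ^ 3 = - I := by rw [pow_succ, hI]; ring
  have h4 : I ^ 4 = 1 := by rw [show (4 : ℕ) = 2 * 2 from rfl, pow_mul, hI]; ring
  have h6 : I ^ 6 = - 1 := by rw [show (6 : ℕ) = 2 * 3 from rfl, pow_mul, hI]; ring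
  funext ⟨i, k⟩
  rw [act_diag]
  have : I ^ (k : ℕ) * (-I) ^ (6 - (k : ℕ)) = - (-1) ^ (k : ℕ) := by
    fin_cases k <;> simp <;> ring_nf <;> simp [h6]
  rw [this]
  have n1 : 15 * (-u 0 + -u 1) = - (15 * (u 0 + u 1)) := by ring
  have n2 : 15 * (-u 0 + u 1) = - (15 * (u 0 - u 1)) := by ring
  fin_cases i <;> fin_cases k <;> simp [sl, n1, n2, div_neg] <;> ring

theorem sgn2 [CharZero K] (I : K) (hI : I ^ 2 = -1) (u : Fin 7 → K) :
    GRel (sl u) (sl ![u 0, -u 1, u 2, -u 3, u 4, -u 5, -u 6]) := by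
  refine ⟨!![-1, 0; 0, -1], !![0, I; I, 0], by simp, by simp; linear_combination -hI, ?_⟩
  have h6 : I ^ 6 = - 1 := by rw [show (6 : ℕ) = 2 * 3 from rfl, pow_mul, hI]; ring
  funext ⟨i, k⟩
  rw [act_anti]
  have : I ^ (6 - (k : ℕ)) * (I) ^ (k : ℕ) = - 1 := by
    rw [← pow_add, ← h6]
    congr 1
    have := k.2
    omega
  rw [this]
  obtain ⟨r0, r1, r2, r3, r4, r5, r6⟩ := rev7
  fin_cases i <;> fin_cases k <;> simp [sl, Fin.rev] <;> ring

theorem claimV [CharZero K] (I : K) (hI : I ^ 2 = -1) (u u' : Fin 7 → K) (hu : good u)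
    (h : wf u' = wf u) : GRel (sl u) (sl u') := by
  obtain ⟨g0, g3, -⟩ := hu
  have w0 : u' 2 = u 2 := congrFun h 0
  have w1 : u' 3 ^ 2 = u 3 ^ 2 := congrFun h 1
  have w2 : u' 0 ^ 2 = u 0 ^ 2 := congrFun h 2
  have w3 : u' 0 * u' 1 * u' 3 = u 0 * u 1 * u 3 := congrFun h 3
  have w4 : u' 4 = u 4 := congrFun h 4
  have w5 : u' 5 * u' 3 = u 5 * u 3 := congrFun h 5
  have w6 : u' 6 * u' 0 * u' 3 = u 6 * u 0 * u 3 := congrFun h 6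
  have h03 := mul_ne_zero g0 g3
  rcases sq_eq_sq_iff_eq_or_eq_neg.mp w1 with e3 | e3 <;>
  rcases sq_eq_sq_iff_eq_or_eq_neg.mp w2 with e0 | e0 <;> rw [e3, e0] at w3 w6 <;> rw [e3] at w5
  · have e1 : u' 1 = u 1 := mul_right_cancel₀ h03 (by linear_combination w3)
    have e5 : u' 5 = u 5 := mul_right_cancel₀ g3 (by linear_combination w5)
    have e6 : u' 6 = u 6 := mul_right_cancel₀ h03 (by linear_combination w6)
    have : u' = u := by funext i; fin_cases i <;> assumption
    rw [this]
    exact ⟨1, 1, by simp, by simp, (act_one _).symm⟩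
  · have e1 : u' 1 = -u 1 := mul_right_cancel₀ h03 (by linear_combination -w3)
    have e5 : u' 5 = u 5 := mul_right_cancel₀ g3 (by linear_combination w5)
    have e6 : u' 6 = -u 6 := mul_right_cancel₀ h03 (by linear_combination -w6)
    have : u' = ![-u 0, -u 1, u 2, u 3, u 4, u 5, -u 6] := by funext i; fin_cases i <;> assumption
    rw [this]
    exact sgn1 I hI u
  · have e1 : u' 1 = -u 1 := mul_right_cancel₀ h03 (by linear_combination -w3)
    have e5 : u' 5 = -u 5 := mul_right_cancel₀ g3 (by linear_combination -w5)
    have e6 : u' 6 = -u 6 := mul_right_cancel₀ h03 (by linear_combination -w6)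
    have : u' = ![u 0, -u 1, u 2, -u 3, u 4, -u 5, -u 6] := by funext i; fin_cases i <;> assumption
    rw [this]
    exact sgn2 I hI u
  · have e1 : u' 1 = u 1 := mul_right_cancel₀ h03 (by linear_combination w3)
    have e5 : u' 5 = -u 5 := mul_right_cancel₀ g3 (by linear_combination -w5)
    have e6 : u' 6 = u 6 := mul_right_cancel₀ h03 (by linear_combination w6)
    have e := (sgn1 I hI u).trans (sgn2 I hI _)
    have : u' = ![-u 0, u 1, u 2, -u 3, u 4, -u 5, u 6] := by funext i; fin_cases i <;> assumption
    rw [this]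
    simpa using e

end


section
variable {Ω : Type} [Field Ω] [Algebra ℂ Ω]

theorem rep_mem (E : IntermediateField ℂ Ω) {h : M2 Ω} (hh : ∀ i j, h i j ∈ E) (d : ℕ)
    (k j : Fin (d + 1)) : rep d h k j ∈ E := by
  have : h = Matrix.map (Matrix.of fun i j => (⟨h i j, hh i j⟩ : E)) (algebraMap E Ω) := by
    ext i j
    rfl
  rw [this, ← rep_map]
  exact (rep d _ k j : E).2

theorem act_mem (E : IntermediateField ℂ Ω) {m h : M2 Ω} {x : Idx → Ω} (hm : ∀ i j, m i j ∈ E)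
    (hh : ∀ i j, h i j ∈ E) (hx : ∀ p, x p ∈ E) (p : Idx) : act m h x p ∈ E :=
  sum_mem fun i _ => sum_mem fun j _ => mul_mem (mul_mem (hm _ _) (rep_mem E hh _ _ _)) (hx _)

theorem inv_entries (E : IntermediateField ℂ Ω) {m : M2 Ω} (hm : ∀ i j, m i j ∈ E) :
    ∀ i j, m⁻¹ i j ∈ E := by
  intro i j
  rw [Matrix.inv_def, Matrix.adjugate_fin_two, Matrix.det_fin_two]
  have : Ring.inverse (m 0 0 * m 1 1 - m 0 1 * m 1 0) ∈ E := by
    rw [Ring.inverse_eq_inv']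
    exact inv_mem (sub_mem (mul_mem (hm _ _) (hm _ _)) (mul_mem (hm _ _) (hm _ _)))
  rw [Matrix.smul_apply, smul_eq_mul]
  refine mul_mem this ?_
  fin_cases i <;> fin_cases j <;> simp [hm]

theorem adj_entries (E : IntermediateField ℂ Ω) {m : M2 Ω} (hm : ∀ i j, m i j ∈ E) :
    ∀ i j, m.adjugate i j ∈ E := by
  intro i j
  rw [Matrix.adjugate_fin_two]
  fin_cases i <;> fin_cases j <;> simp [hm]

/-- `x` and `k` further elements generate `v` -/
def Cov (v : Idx → Ω) (k : ℕ) (x : Idx → Ω) : Prop :=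
  ∃ l : List Ω, l.length = k ∧ ∀ E : IntermediateField ℂ Ω, (∀ a ∈ l, a ∈ E) → (∀ p, x p ∈ E) →
    ∀ p, v p ∈ E

theorem Cov.step {v x y : Idx → Ω} {k : ℕ} (h : Cov v k x) (l : List Ω) {m g : M2 Ω}
    (hm : IsUnit m.det) (hg : g.det = 1) (hy : y = act m g x)
    (hl : ∀ E : IntermediateField ℂ Ω, (∀ a ∈ l, a ∈ E) → (∀ i j, m i j ∈ E) ∧ (∀ i j, g i j ∈ E)) :
    Cov v (k + l.length) y := by
  obtain ⟨l0, rfl, h0⟩ := h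
  refine ⟨l0 ++ l, by simp, fun E hE hyE => h0 E (fun a ha => hE a (by simp [ha])) ?_⟩
  obtain ⟨e1, e2⟩ := hl E (fun a ha => hE a (by simp [ha]))
  rw [← act_inv hm hg (x := x), ← hy]
  exact act_mem E (inv_entries E e1) (adj_entries E e2) hyE

open scoped IntermediateField.algebraAdjoinAdjoin in
theorem acl_top {v : Idx → Ω} (hv : IsTranscendenceBasis ℂ v) (S : Set Ω)
    (h : ∀ p, v p ∈ algebraicClosure (IntermediateField.adjoin ℂ S) Ω) :
    Algebra.IsAlgebraic (Algebra.adjoin ℂ S) Ω := by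
  have h1 := hv.isAlgebraic_field
  set L := IntermediateField.adjoin ℂ S
  set A := (algebraicClosure L Ω)
  have hle : IntermediateField.adjoin ℂ (Set.range v) ≤ A.restrictScalars ℂ := by
    rw [IntermediateField.adjoin_le_iff]
    rintro _ ⟨p, rfl⟩
    exact h p
  have hA : Algebra.IsAlgebraic A Ω := by
    constructor
    intro x
    obtain ⟨p, hp, hx⟩ := h1.isAlgebraic x
    let f : IntermediateField.adjoin ℂ (Set.range v) →+* A := (IntermediateField.inclusion hle).toRingHom
    refine ⟨p.map f, ?_, ?_⟩
    · exact (Polynomial.map_ne_zero_iff f.injective).mpr hp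
    · rw [← hx, Polynomial.aeval_def, Polynomial.eval₂_map, Polynomial.aeval_def]
      rfl
  have h2 : Algebra.IsAlgebraic L Ω := Algebra.IsAlgebraic.trans L A Ω
  constructor
  intro x
  exact (IsFractionRing.isAlgebraic_iff (Algebra.adjoin ℂ S) L Ω).mpr (h2.isAlgebraic x)

theorem count {v x : Idx → Ω} (hv : IsTranscendenceBasis ℂ v) {k : ℕ} (h : Cov v k x) (l : List Ω)
    (hk : k + l.length < 14)
    (hl : ∀ E : IntermediateField ℂ Ω, (∀ a ∈ l, a ∈ E) → ∀ p, x p ∈ E) : False := by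
  obtain ⟨l0, rfl, h0⟩ := h
  have := acl_top hv {a | a ∈ l0 ++ l} (fun p => by
    have := h0 (IntermediateField.adjoin ℂ {a | a ∈ l0 ++ l})
      (fun a ha => IntermediateField.subset_adjoin _ _ (by simp [ha]))
      (hl _ (fun a ha => IntermediateField.subset_adjoin _ _ (by simp [ha]))) p
    rw [mem_algebraicClosure_iff]
    exact isAlgebraic_algebraMap
      (⟨_, this⟩ : IntermediateField.adjoin ℂ {a | a ∈ l0 ++ l}))
  have h1 := Algebra.IsAlgebraic.trdeg_le_cardinalMk ℂ {a | a ∈ l0 ++ l}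
  have h2 := hv.cardinalMk_eq_trdeg
  rw [← h2] at h1
  classical
  have h3 : {a | a ∈ l0 ++ l} = ((l0 ++ l).toFinset : Set Ω) := by ext; simp
  rw [h3] at h1
  simp only [Cardinal.mk_fintype, Finset.coe_sort_coe, Fintype.card_coe] at h1
  have h4 : Fintype.card Idx ≤ (l0 ++ l).toFinset.card := by exact_mod_cast h1
  have h5 := List.toFinset_card_le (l0 ++ l)
  simp [Idx] at h4 h5
  omega

theorem idx_cases {P : Idx → Prop} (a0 : P (0,0)) (a1 : P (0,1)) (a2 : P (0,2)) (a3 : P (0,3))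
  (a4 : P (0,4)) (a5 : P (0,5)) (a6 : P (0,6)) (b0 : P (1,0)) (b1 : P (1,1)) (b2 : P (1,2))
  (b3 : P (1,3)) (b4 : P (1,4)) (b5 : P (1,5)) (b6 : P (1,6)) (p : Idx) : P p := by
  obtain ⟨i, j⟩ := p
  fin_cases i <;> fin_cases j <;> assumption

theorem solve_mem (E : IntermediateField ℂ Ω) {a b s : Ω} (ha : a ∈ E) (ha0 : a ≠ 0) (h : a * b = s)
    (hs : s ∈ E) : b ∈ E := by
  have : b = s / a := by field_simp; linear_combination h
  rw [this]
  exact div_mem hs ha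

end


section
variable {Ω : Type} [Field Ω] [Algebra ℂ Ω] [CharZero Ω]

theorem gen_ne {v : Idx → Ω} (hv : AlgebraicIndependent ℂ v) (f : MvPolynomial Idx ℂ) (c : Idx → ℂ)
    (h : eval c f ≠ 0) : aeval v f ≠ 0 := by
  intro h0
  have := (algebraicIndependent_iff.mp hv) f h0
  rw [this] at h
  simp at h

theorem q2_map {R S : Type*} [CommRing R] [CommRing S] (f : R →+* S) (x : Idx → R) :
    q2 (fun p => f (x p)) = f (q2 x) := by
  simp [q2, map_ofNat]

theorem q0_map {R S : Type*} [CommRing R] [CommRing S] (f : R →+* S) (x : Idx → R) :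
    q0 (fun p => f (x p)) = f (q0 x) := by
  simp [q0, map_ofNat]

theorem gen_q2 {v : Idx → Ω} (hv : AlgebraicIndependent ℂ v) : q2 v ≠ 0 := by
  have := gen_ne hv (q2 X) (fun p => if p = (0,3) ∨ p = (1,4) then 1 else 0) (by simp [q2, map_ofNat])
  have e := q2_map (aeval v : MvPolynomial Idx ℂ →ₐ[ℂ] Ω).toRingHom X
  simp at e
  rwa [← e] at this

theorem gen_disc {v : Idx → Ω} (hv : AlgebraicIndependent ℂ v) : q1 v ^ 2 - 4 * q2 v * q0 v ≠ 0 := by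
  have := gen_ne hv (q1 X ^ 2 - 4 * q2 X * q0 X) (fun p => if p = (0,4) ∨ p = (1,2) then 1 else 0)
    (by simp [q2, q1, q0, map_ofNat])
  have e := q2_map (aeval v : MvPolynomial Idx ℂ →ₐ[ℂ] Ω).toRingHom X
  have e0 := q0_map (aeval v : MvPolynomial Idx ℂ →ₐ[ℂ] Ω).toRingHom X
  have e1 := q1_map (aeval v : MvPolynomial Idx ℂ →ₐ[ℂ] Ω).toRingHom X
  have e2 : ⇑(aeval v : MvPolynomial Idx ℂ →ₐ[ℂ] Ω).toRingHom ∘ X = v := by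
    funext p; simp
  rw [e2] at e1
  simp at e e0 e1
  rw [e, e0, e1]
  simpa [map_ofNat] using this

theorem stage1 [IsAlgClosed Ω] {v : Idx → Ω} (hv : AlgebraicIndependent ℂ v) :
    ∃ y, GRel v y ∧ Cov v 2 y ∧ q2 y = 0 ∧ q0 y = 0 ∧ q1 y ≠ 0 := by
  have h2 := gen_q2 hv
  have hd := gen_disc hv
  obtain ⟨s, hs⟩ := IsAlgClosed.exists_pow_nat_eq (q1 v ^ 2 - 4 * q2 v * q0 v) (n := 2) (by norm_num)
  have hs0 : s ≠ 0 := by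
    rintro rfl
    apply hd
    rw [← hs]; simp
  obtain ⟨r1, hr1⟩ : ∃ r1, r1 = (- q1 v + s) / (2 * q2 v) := ⟨_, rfl⟩
  obtain ⟨r2, hr2⟩ : ∃ r1, r1 = (- q1 v - s) / (2 * q2 v) := ⟨_, rfl⟩
  have d12 : r1 - r2 = s / q2 v := by rw [hr1, hr2]; field_simp; ring
  have d0 : r1 - r2 ≠ 0 := by rw [d12]; exact div_ne_zero hs0 h2
  have z1 : q2 v * r1 ^ 2 + q1 v * r1 + q0 v = 0 := by
    rw [hr1]; field_simp; linear_combination hs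
  have z2 : q2 v * r2 ^ 2 + q1 v * r2 + q0 v = 0 := by
    rw [hr2]; field_simp; linear_combination hs
  have z3 : 2 * q2 v * r1 * r2 + q1 v * (r1 + r2) + 2 * q0 v = - s ^ 2 / q2 v := by
    rw [hr1, hr2]; field_simp; linear_combination hs
  have hdet : (!![r1, r2 / (r1 - r2); 1, 1 / (r1 - r2)] : M2 Ω).det = 1 := by
    rw [Matrix.det_fin_two]
    simp
    field_simp
  obtain ⟨e2, e1, e0⟩ := QEq_all (1 : M2 Ω) !![r1, r2 / (r1 - r2); 1, 1 / (r1 - r2)] hdet v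
  refine ⟨act 1 !![r1, r2 / (r1 - r2); 1, 1 / (r1 - r2)] v, ⟨1, _, by simp, hdet, rfl⟩, ?_, ?_, ?_, ?_⟩
  · have c0 : Cov v 0 v := ⟨[], rfl, fun E _ h => h⟩
    refine c0.step [r1, r2] (m := 1) (by simp) hdet rfl fun E hE => ?_
    simp at hE
    obtain ⟨k1, k2⟩ := hE
    have k3 := sub_mem k1 k2
    constructor
    · intro i j
      fin_cases i <;> fin_cases j <;> simp
    · intro i j
      fin_cases i <;> fin_cases j <;> simp
      · exact k1
      · exact div_mem k2 k3
      · exact k3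
  · rw [e2]
    simp
    linear_combination z1
  · rw [e0]
    simp
    field_simp
    linear_combination z2
  · rw [e1]
    simp
    have : 2 * q2 v * r1 * (r2 / (r1 - r2)) + q1 v * (r1 * (r1 - r2)⁻¹ + r2 / (r1 - r2)) +
      2 * q0 v * (r1 - r2)⁻¹ = (- s ^ 2 / q2 v) / (r1 - r2) := by
      rw [← z3]
      field_simp
    rw [this]
    refine div_ne_zero (div_ne_zero ?_ h2) d0
    simpa using hs0

theorem ne03 {v y : Idx → Ω} (hv : IsTranscendenceBasis ℂ v) (hc : Cov v 2 y) (h2 : q2 y = 0)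
    (h0 : q0 y = 0) : y (0,3) ≠ 0 := by
  intro h3
  rw [q2, h3] at h2
  rw [q0, h3] at h0
  have k15 : (15 : Ω) ≠ 0 := by norm_num
  have k5 : (5 : Ω) ≠ 0 := by norm_num
  by_cases h5 : y (0,5) = 0
  · by_cases h1 : y (0,1) = 0
    · refine count hv hc [y (0,0), y (0,2), y (0,4), y (0,6), y (1,0), y (1,1), y (1,2), y (1,3), y (1,4),
        y (1,5), y (1,6)] (by simp) fun E hl => ?_
      simp at hl
      obtain ⟨a0, a2, a4, a6, b0, b1, b2, b3, b4, b5, b6⟩ := hl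
      exact idx_cases a0 (h1 ▸ zero_mem E) a2 (h3 ▸ zero_mem E) a4 (h5 ▸ zero_mem E) a6 b0 b1 b2 b3 b4 b5 b6
    · refine count hv hc [y (0,0), y (0,1), y (0,2), y (0,4), y (0,6), y (1,0), y (1,1), y (1,2), y (1,3), y (1,4),
        y (1,5)] (by simp) fun E hl => ?_
      simp at hl
      obtain ⟨a0, a1, a2, a4, a6, b0, b1, b2, b3, b4, b5⟩ := hl
      have b6 : y (1,6) ∈ E := by
        refine solve_mem E (a := 15 * y (0,1)) (mul_mem (ofNat_mem E 15) a1) (mul_ne_zero k15 h1)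
          (s := 15 * (y (0,6) * y (1,1)) + 5 * (y (0,2) * y (1,5)) + 3 * (y (0,4) * y (1,3)))
          (by rw [h5] at h2; linear_combination -h2) ?_
        repeat' first | assumption | apply add_mem | apply sub_mem | apply mul_mem | apply ofNat_mem
      exact idx_cases a0 a1 a2 (h3 ▸ zero_mem E) a4 (h5 ▸ zero_mem E) a6 b0 b1 b2 b3 b4 b5 b6
  · refine count hv hc [y (0,0), y (0,1), y (0,2), y (0,4), y (0,5), y (0,6), y (1,1), y (1,3), y (1,4),
        y (1,5), y (1,6)] (by simp) fun E hl => ?_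
    simp at hl
    obtain ⟨a0, a1, a2, a4, a5, a6, b1, b3, b4, b5, b6⟩ := hl
    have b2 : y (1,2) ∈ E := by
      refine solve_mem E (a := 5 * y (0,5)) (mul_mem (ofNat_mem E 5) a5) (mul_ne_zero k5 h5)
          (s := 15 * (y (0,6) * y (1,1) - y (0,1) * y (1,6)) + 5 * (y (0,2) * y (1,5)) + 3 * (y (0,4) * y (1,3)))
          (by linear_combination -h2) ?_
      repeat' first | assumption | apply add_mem | apply sub_mem | apply mul_mem | apply ofNat_mem
    have b0 : y (1,0) ∈ E := by
      refine solve_mem E (a := 15 * y (0,5)) (mul_mem (ofNat_mem E 15) a5) (mul_ne_zero k15 h5)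
          (s := 15 * (y (0,0) * y (1,5)) + 5 * (y (0,4) * y (1,1) - y (0,1) * y (1,4)) + 3 * (y (0,2) * y (1,3)))
          (by linear_combination h0) ?_
      repeat' first | assumption | apply add_mem | apply sub_mem | apply mul_mem | apply ofNat_mem
    exact idx_cases a0 a1 a2 (h3 ▸ zero_mem E) a4 a5 a6 b0 b1 b2 b3 b4 b5 b6

theorem stage2 {v y : Idx → Ω} (hv : IsTranscendenceBasis ℂ v) (hc : Cov v 2 y) (h2 : q2 y = 0)
    (h0 : q0 y = 0) (h1 : q1 y ≠ 0) : ∃ z, GRel y z ∧ Cov v 4 z ∧ q2 z = 0 ∧ q0 z = 0 ∧ q1 z ≠ 0 ∧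
      z (0,3) = 1 ∧ z (1,3) = 0 := by
  have h3 := ne03 hv hc h2 h0
  have hdet : (!![(y (0,3))⁻¹, 0; - y (1,3) / y (0,3), 1] : M2 Ω).det = (y (0,3))⁻¹ := by
    rw [Matrix.det_fin_two]; simp
  have hu : IsUnit (!![(y (0,3))⁻¹, 0; - y (1,3) / y (0,3), 1] : M2 Ω).det := by
    rw [hdet]; simpa using h3
  have h11 : (!![1, 0; 0, 1] : M2 Ω).det = 1 := by simp
  obtain ⟨e2, e1, e0⟩ := QEq_all (!![(y (0,3))⁻¹, 0; - y (1,3) / y (0,3), 1] : M2 Ω) (!![1, 0; 0, 1] : M2 Ω) h11 y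
  refine ⟨_, ⟨_, _, hu, h11, rfl⟩, ?_, ?_, ?_, ?_, ?_, ?_⟩
  · refine hc.step [y (0,3), y (1,3)] hu h11 rfl fun E hE => ?_
    simp at hE
    obtain ⟨k1, k2⟩ := hE
    constructor <;> intro i j <;> fin_cases i <;> fin_cases j <;> simp
    · exact k1
    · exact div_mem (neg_mem k2) k1
  · rw [e2]; simp [h2]
  · rw [e0]; simp [h0]
  · rw [e1]; simp [h2, h0, h1, h3]
  · rw [act_diag]; simp [h3]
  · rw [act_diag]; simp [h3]

theorem ne14 {v y : Idx → Ω} (hv : IsTranscendenceBasis ℂ v) (hc : Cov v 4 y) (h2 : q2 y = 0)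
    (h0 : q0 y = 0) (h03 : y (0,3) = 1) (h13 : y (1,3) = 0) : y (1,4) ≠ 0 := by
  intro h4
  rw [q2, h03, h13, h4] at h2
  rw [q0, h03, h13, h4] at h0
  have k15 : (15 : Ω) ≠ 0 := by norm_num
  have k5 : (5 : Ω) ≠ 0 := by norm_num
  by_cases h1 : y (1,1) = 0
  · by_cases h5 : y (1,5) = 0
    · refine count hv hc [y (0,0), y (0,1), y (0,2), y (0,4), y (0,5), y (0,6), y (1,0), y (1,2), y (1,6)]
        (by simp) fun E hl => ?_
      simp at hl
      obtain ⟨a0, a1, a2, a4, a5, a6, b0, b2, b6⟩ := hl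
      exact idx_cases a0 a1 a2 (h03 ▸ one_mem E) a4 a5 a6 b0 (h1 ▸ zero_mem E) b2 (h13 ▸ zero_mem E)
        (h4 ▸ zero_mem E) (h5 ▸ zero_mem E) b6
    · refine count hv hc [y (0,0), y (0,1), y (0,4), y (0,5), y (0,6), y (1,0), y (1,2), y (1,5), y (1,6)]
        (by simp) fun E hl => ?_
      simp at hl
      obtain ⟨a0, a1, a4, a5, a6, b0, b2, b5, b6⟩ := hl
      have a2 : y (0,2) ∈ E := by
        refine solve_mem E (a := 5 * y (1,5)) (mul_mem (ofNat_mem E 5) b5) (mul_ne_zero k5 h5)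
          (s := 15 * (y (0,1) * y (1,6)) + 5 * (y (0,5) * y (1,2)))
          (by rw [h1] at h2; linear_combination h2) ?_
        repeat' first | assumption | apply add_mem | apply sub_mem | apply mul_mem | apply ofNat_mem
      exact idx_cases a0 a1 a2 (h03 ▸ one_mem E) a4 a5 a6 b0 (h1 ▸ zero_mem E) b2 (h13 ▸ zero_mem E)
        (h4 ▸ zero_mem E) b5 b6
  · refine count hv hc [y (0,0), y (0,1), y (0,2), y (0,5), y (1,0), y (1,1), y (1,2), y (1,5), y (1,6)]
        (by simp) fun E hl => ?_
    simp at hl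
    obtain ⟨a0, a1, a2, a5, b0, b1, b2, b5, b6⟩ := hl
    have a6 : y (0,6) ∈ E := by
      refine solve_mem E (a := 15 * y (1,1)) (mul_mem (ofNat_mem E 15) b1) (mul_ne_zero k15 h1)
          (s := 15 * (y (0,1) * y (1,6)) + 5 * (y (0,5) * y (1,2) - y (0,2) * y (1,5)))
          (by linear_combination h2) ?_
      repeat' first | assumption | apply add_mem | apply sub_mem | apply mul_mem | apply ofNat_mem
    have a4 : y (0,4) ∈ E := by
      refine solve_mem E (a := 5 * y (1,1)) (mul_mem (ofNat_mem E 5) b1) (mul_ne_zero k5 h1)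
          (s := 15 * (y (0,5) * y (1,0) - y (0,0) * y (1,5)) + 3 * y (1,2))
          (by linear_combination -h0) ?_
      repeat' first | assumption | apply add_mem | apply sub_mem | apply mul_mem | apply ofNat_mem
    exact idx_cases a0 a1 a2 (h03 ▸ one_mem E) a4 a5 a6 b0 b1 b2 (h13 ▸ zero_mem E)
        (h4 ▸ zero_mem E) b5 b6

theorem ne12 {v y : Idx → Ω} (hv : IsTranscendenceBasis ℂ v) (hc : Cov v 4 y) (h2 : q2 y = 0)
    (h0 : q0 y = 0) (h03 : y (0,3) = 1) (h13 : y (1,3) = 0) : y (1,2) ≠ 0 := by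
  intro h4
  rw [q2, h03, h13, h4] at h2
  rw [q0, h03, h13, h4] at h0
  have k15 : (15 : Ω) ≠ 0 := by norm_num
  have k5 : (5 : Ω) ≠ 0 := by norm_num
  by_cases h1 : y (1,5) = 0
  · by_cases h5 : y (1,1) = 0
    · refine count hv hc [y (0,0), y (0,1), y (0,2), y (0,4), y (0,5), y (0,6), y (1,0), y (1,4), y (1,6)]
        (by simp) fun E hl => ?_
      simp at hl
      obtain ⟨a0, a1, a2, a4, a5, a6, b0, b4, b6⟩ := hl
      exact idx_cases a0 a1 a2 (h03 ▸ one_mem E) a4 a5 a6 b0 (h5 ▸ zero_mem E) (h4 ▸ zero_mem E)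
        (h13 ▸ zero_mem E) b4 (h1 ▸ zero_mem E) b6
    · refine count hv hc [y (0,0), y (0,1), y (0,2), y (0,5), y (0,6), y (1,0), y (1,1), y (1,4), y (1,6)]
        (by simp) fun E hl => ?_
      simp at hl
      obtain ⟨a0, a1, a2, a5, a6, b0, b1, b4, b6⟩ := hl
      have a4 : y (0,4) ∈ E := by
        refine solve_mem E (a := 5 * y (1,1)) (mul_mem (ofNat_mem E 5) b1) (mul_ne_zero k5 h5)
          (s := 15 * (y (0,5) * y (1,0)) + 5 * (y (0,1) * y (1,4)))
          (by rw [h1] at h0; linear_combination -h0) ?_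
        repeat' first | assumption | apply add_mem | apply sub_mem | apply mul_mem | apply ofNat_mem
      exact idx_cases a0 a1 a2 (h03 ▸ one_mem E) a4 a5 a6 b0 b1 (h4 ▸ zero_mem E) (h13 ▸ zero_mem E)
        b4 (h1 ▸ zero_mem E) b6
  · refine count hv hc [y (0,1), y (0,4), y (0,5), y (0,6), y (1,0), y (1,1), y (1,4), y (1,5), y (1,6)]
        (by simp) fun E hl => ?_
    simp at hl
    obtain ⟨a1, a4, a5, a6, b0, b1, b4, b5, b6⟩ := hl
    have a2 : y (0,2) ∈ E := by
      refine solve_mem E (a := 5 * y (1,5)) (mul_mem (ofNat_mem E 5) b5) (mul_ne_zero k5 h1)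
          (s := 15 * (y (0,1) * y (1,6) - y (0,6) * y (1,1)) + 3 * y (1,4))
          (by linear_combination h2) ?_
      repeat' first | assumption | apply add_mem | apply sub_mem | apply mul_mem | apply ofNat_mem
    have a0 : y (0,0) ∈ E := by
      refine solve_mem E (a := 15 * y (1,5)) (mul_mem (ofNat_mem E 15) b5) (mul_ne_zero k15 h1)
          (s := 15 * (y (0,5) * y (1,0)) + 5 * (y (0,1) * y (1,4) - y (0,4) * y (1,1)))
          (by linear_combination -h0) ?_
      repeat' first | assumption | apply add_mem | apply sub_mem | apply mul_mem | apply ofNat_mem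
    exact idx_cases a0 a1 a2 (h03 ▸ one_mem E) a4 a5 a6 b0 b1 (h4 ▸ zero_mem E) (h13 ▸ zero_mem E)
        b4 b5 b6

theorem stage3 [IsAlgClosed Ω] {v y : Idx → Ω} (hv : IsTranscendenceBasis ℂ v) (hc : Cov v 4 y) (h2 : q2 y = 0)
    (h0 : q0 y = 0) (h1 : q1 y ≠ 0) (h03 : y (0,3) = 1) (h13 : y (1,3) = 0) :
    ∃ z, GRel y z ∧ Cov v 7 z ∧ q2 z = 0 ∧ q0 z = 0 ∧ q1 z ≠ 0 ∧
      z (0,3) = 1 ∧ z (1,3) = 0 ∧ z (1,2) = 1 ∧ z (1,4) = 1 ∧ z (0,2) = - z (0,4) := by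
  have n4 := ne14 hv hc h2 h0 h03 h13
  have n2 := ne12 hv hc h2 h0 h03 h13
  obtain ⟨t, ht⟩ := IsAlgClosed.exists_pow_nat_eq (y (1,2) / y (1,4)) (n := 4) (by norm_num)
  have t0 : t ≠ 0 := by
    rintro rfl
    have := div_ne_zero n2 n4
    rw [← ht] at this
    simp at this
  have ht' : t ^ 4 * y (1,4) = y (1,2) := by rw [ht]; field_simp
  obtain ⟨ν, hν⟩ : ∃ ν, ν = t ^ 2 / y (1,2) := ⟨_, rfl⟩
  have ν0 : ν ≠ 0 := by rw [hν]; exact div_ne_zero (pow_ne_zero _ t0) n2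
  obtain ⟨κ, hκ⟩ : ∃ κ, κ = (t ^ 4 * y (0,4) + y (0,2)) / (2 * y (1,2)) := ⟨_, rfl⟩
  have hdet : (!![1, -κ; 0, ν] : M2 Ω).det = ν := by
    rw [Matrix.det_fin_two]; simp
  have hu : IsUnit (!![1, -κ; 0, ν] : M2 Ω).det := by
    rw [hdet]; simpa using ν0
  have h11 : (!![t, 0; 0, t⁻¹] : M2 Ω).det = 1 := by simp [t0]
  obtain ⟨e2, e1, e0⟩ := QEq_all (!![1, -κ; 0, ν] : M2 Ω) (!![t, 0; 0, t⁻¹] : M2 Ω) h11 y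
  refine ⟨_, ⟨_, _, hu, h11, rfl⟩, ?_, ?_, ?_, ?_, ?_, ?_, ?_, ?_, ?_⟩
  · refine hc.step [t, ν, κ] hu h11 rfl fun E hE => ?_
    simp at hE
    obtain ⟨k1, k2, k3⟩ := hE
    constructor <;> intro i j <;> fin_cases i <;> fin_cases j <;> simp <;> assumption
  · rw [e2]; simp [h2, h0]
  · rw [e0]; simp [h2, h0]
  · rw [e1]; simp [h2, h0, h1, ν0, t0]
  · rw [act_diag]; simp [h03, h13, t0]
  · rw [act_diag]; simp [h13]
  · rw [act_diag]; simp [hν]; field_simp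
  · rw [act_diag]; simp [hν]; field_simp; exact ht'
  · rw [act_diag, act_diag]; simp [hκ]; field_simp; linear_combination -(t ^ 4 * y (0,4) + y (0,2)) * ht'

end


section
variable {Ω : Type} [Field Ω] [Algebra ℂ Ω] [CharZero Ω]

/-- normalised points -/
structure Nrm (z : Idx → Ω) : Prop where
  e2 : q2 z = 0
  e0 : q0 z = 0
  z03 : z (0,3) = 1
  z13 : z (1,3) = 0
  z12 : z (1,2) = 1
  z14 : z (1,4) = 1
  z02 : z (0,2) = - z (0,4)

theorem Nrm.eq2 {z : Idx → Ω} (h : Nrm z) : 15 * (z (0,6) * z (1,1)) = 15 * (z (0,1) * z (1,6)) +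
    5 * (z (0,5) + z (0,4) * z (1,5)) + 3 := by
  have := h.e2
  rw [q2, h.z03, h.z13, h.z12, h.z14, h.z02] at this
  linear_combination this

theorem Nrm.eq0 {z : Idx → Ω} (h : Nrm z) : 15 * (z (0,0) * z (1,5)) = 15 * (z (0,5) * z (1,0)) -
    5 * (z (0,4) * z (1,1) - z (0,1)) + 3 := by
  have := h.e0
  rw [q0, h.z03, h.z13, h.z12, h.z14, h.z02] at this
  linear_combination -this

theorem n11 {v z : Idx → Ω} (hv : IsTranscendenceBasis ℂ v) (hc : Cov v 7 z) (h : Nrm z) :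
    z (1,1) ≠ 0 := by
  intro h1
  have e2 := h.eq2
  have e0 := h.eq0
  have k15 : (15 : Ω) ≠ 0 := by norm_num
  have k5 : (5 : Ω) ≠ 0 := by norm_num
  rw [h1] at e2 e0
  by_cases h5 : z (1,5) = 0
  · refine count hv hc [z (0,0), z (0,1), z (0,4), z (0,6), z (1,0), z (1,6)] (by simp) fun E hl => ?_
    simp at hl
    obtain ⟨a0, a1, a4, a6, b0, b6⟩ := hl
    have b5 : z (1,5) ∈ E := h5 ▸ zero_mem E
    have a5 : z (0,5) ∈ E := by
      refine solve_mem E (a := - 5) (neg_mem (ofNat_mem E 5)) (by norm_num)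
        (s := 15 * (z (0,1) * z (1,6)) + 5 * (z (0,4) * z (1,5)) + 3) (by linear_combination e2) ?_
      repeat' first | assumption | apply add_mem | apply sub_mem | apply mul_mem | apply ofNat_mem
    exact idx_cases a0 a1 (h.z02 ▸ neg_mem a4) (h.z03 ▸ one_mem E) a4 a5 a6 b0 (h1 ▸ zero_mem E)
      (h.z12 ▸ one_mem E) (h.z13 ▸ zero_mem E) (h.z14 ▸ one_mem E) b5 b6
  · refine count hv hc [z (1,5), z (0,1), z (0,4), z (0,6), z (1,0), z (1,6)] (by simp) fun E hl => ?_
    simp at hl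
    obtain ⟨b5, a1, a4, a6, b0, b6⟩ := hl
    have a5 : z (0,5) ∈ E := by
      refine solve_mem E (a := - 5) (neg_mem (ofNat_mem E 5)) (by norm_num)
        (s := 15 * (z (0,1) * z (1,6)) + 5 * (z (0,4) * z (1,5)) + 3) (by linear_combination e2) ?_
      repeat' first | assumption | apply add_mem | apply sub_mem | apply mul_mem | apply ofNat_mem
    have a0 : z (0,0) ∈ E := by
      refine solve_mem E (a := 15 * z (1,5)) (mul_mem (ofNat_mem E 15) b5) (mul_ne_zero k15 h5)
        (s := 15 * (z (0,5) * z (1,0)) + 5 * z (0,1) + 3) (by linear_combination e0) ?_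
      repeat' first | assumption | apply add_mem | apply sub_mem | apply mul_mem | apply ofNat_mem
    exact idx_cases a0 a1 (h.z02 ▸ neg_mem a4) (h.z03 ▸ one_mem E) a4 a5 a6 b0 (h1 ▸ zero_mem E)
      (h.z12 ▸ one_mem E) (h.z13 ▸ zero_mem E) (h.z14 ▸ one_mem E) b5 b6

theorem n15 {v z : Idx → Ω} (hv : IsTranscendenceBasis ℂ v) (hc : Cov v 7 z) (h : Nrm z) :
    z (1,5) ≠ 0 := by
  intro h5
  have h1 := n11 hv hc h
  have e2 := h.eq2
  have e0 := h.eq0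
  have k15 : (15 : Ω) ≠ 0 := by norm_num
  rw [h5] at e2 e0
  refine count hv hc [z (0,0), z (1,1), z (0,4), z (0,5), z (1,0), z (1,6)] (by simp) fun E hl => ?_
  simp at hl
  obtain ⟨a0, b1, a4, a5, b0, b6⟩ := hl
  have a1 : z (0,1) ∈ E := by
      refine solve_mem E (a := - 5) (neg_mem (ofNat_mem E 5)) (by norm_num)
        (s := 15 * (z (0,5) * z (1,0)) - 5 * (z (0,4) * z (1,1)) + 3) (by linear_combination e0) ?_
      repeat' first | assumption | apply add_mem | apply sub_mem | apply mul_mem | apply ofNat_mem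
  have a6 : z (0,6) ∈ E := by
      refine solve_mem E (a := 15 * z (1,1)) (mul_mem (ofNat_mem E 15) b1) (mul_ne_zero k15 h1)
        (s := 15 * (z (0,1) * z (1,6)) + 5 * z (0,5) + 3) (by linear_combination e2) ?_
      repeat' first | assumption | apply add_mem | apply sub_mem | apply mul_mem | apply ofNat_mem
  exact idx_cases a0 a1 (h.z02 ▸ neg_mem a4) (h.z03 ▸ one_mem E) a4 a5 a6 b0 b1
      (h.z12 ▸ one_mem E) (h.z13 ▸ zero_mem E) (h.z14 ▸ one_mem E) (h5 ▸ zero_mem E) b6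

theorem six {v z : Idx → Ω} (hv : IsTranscendenceBasis ℂ v) (hc : Cov v 7 z) (h : Nrm z) (l : List Ω)
    (hl : l.length = 6) (hE : ∀ E : IntermediateField ℂ Ω, (∀ a ∈ l, a ∈ E) → z (0,1) ∈ E ∧ z (0,4) ∈ E ∧
      z (0,5) ∈ E ∧ z (1,0) ∈ E ∧ z (1,1) ∈ E ∧ z (1,5) ∈ E ∧ z (1,6) ∈ E) : False := by
  have h1 := n11 hv hc h
  have h5 := n15 hv hc h
  have e2 := h.eq2
  have e0 := h.eq0
  have k15 : (15 : Ω) ≠ 0 := by norm_num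
  refine count hv hc l (by rw [hl]; norm_num) fun E hl => ?_
  obtain ⟨a1, a4, a5, b0, b1, b5, b6⟩ := hE E hl
  have a6 : z (0,6) ∈ E := by
      refine solve_mem E (a := 15 * z (1,1)) (mul_mem (ofNat_mem E 15) b1) (mul_ne_zero k15 h1)
        (s := 15 * (z (0,1) * z (1,6)) + 5 * (z (0,5) + z (0,4) * z (1,5)) + 3) (by linear_combination e2) ?_
      repeat' first | assumption | apply add_mem | apply sub_mem | apply mul_mem | apply ofNat_mem
  have a0 : z (0,0) ∈ E := by
      refine solve_mem E (a := 15 * z (1,5)) (mul_mem (ofNat_mem E 15) b5) (mul_ne_zero k15 h5)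
        (s := 15 * (z (0,5) * z (1,0)) - 5 * (z (0,4) * z (1,1) - z (0,1)) + 3) (by linear_combination e0) ?_
      repeat' first | assumption | apply add_mem | apply sub_mem | apply mul_mem | apply ofNat_mem
  exact idx_cases a0 a1 (h.z02 ▸ neg_mem a4) (h.z03 ▸ one_mem E) a4 a5 a6 b0 b1
      (h.z12 ▸ one_mem E) (h.z13 ▸ zero_mem E) (h.z14 ▸ one_mem E) b5 b6

theorem exists_slice [IsAlgClosed Ω] {v : Idx → Ω} (hv : IsTranscendenceBasis ℂ v) :
    ∃ u : Fin 7 → Ω, good u ∧ GRel v (sl u) ∧ Cov v 7 (sl u) := by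
  obtain ⟨x, gx, cx, x2, x0, x1⟩ := stage1 hv.1
  obtain ⟨y, gy, cy, y2, y0, y1, y3, y3'⟩ := stage2 hv cx x2 x0 x1
  obtain ⟨z, gz, cz, z2, z0, z1, w1, w2, w3, w4, w5⟩ := stage3 hv cy y2 y0 y1 y3 y3'
  have hN : Nrm z := ⟨z2, z0, w1, w2, w3, w4, w5⟩
  have n1 := n11 hv cz hN
  have n5 := n15 hv cz hN
  have e2 := hN.eq2
  have e0 := hN.eq0
  have k15 : (15 : Ω) ≠ 0 := by norm_num
  have c0 : z (1,5) + z (1,1) ≠ 0 := by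
    intro h
    refine six hv cz hN [z (0,1), z (0,4), z (0,5), z (1,0), z (1,5), z (1,6)] rfl fun E hl => ?_
    simp at hl
    obtain ⟨a1, a4, a5, b0, b5, b6⟩ := hl
    have : z (1,1) = - z (1,5) := by linear_combination h
    exact ⟨a1, a4, a5, b0, this ▸ neg_mem b5, b5, b6⟩
  have D0 : z (1,6) - z (1,0) ≠ 0 := by
    intro h
    refine six hv cz hN [z (0,1), z (0,4), z (0,5), z (1,0), z (1,5), z (1,1)] rfl fun E hl => ?_
    simp at hl
    obtain ⟨a1, a4, a5, b0, b5, b1⟩ := hl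
    have : z (1,6) = z (1,0) := by linear_combination h
    exact ⟨a1, a4, a5, b0, b1, b5, this ▸ b0⟩
  let u : Fin 7 → Ω := ![(z (1,5) + z (1,1)) / 2, (z (1,5) - z (1,1)) / 2, (z (1,6) + z (1,0)) / 2,
    (z (1,6) - z (1,0)) / 2, (z (0,5) + z (0,1)) / 2, (z (0,5) - z (0,1)) / 2, z (0,4)]
  have u0 : u 0 = (z (1,5) + z (1,1)) / 2 := rfl
  have u1 : u 1 = (z (1,5) - z (1,1)) / 2 := rfl
  have u2 : u 2 = (z (1,6) + z (1,0)) / 2 := rfl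
  have u3 : u 3 = (z (1,6) - z (1,0)) / 2 := rfl
  have u4 : u 4 = (z (0,5) + z (0,1)) / 2 := rfl
  have u5 : u 5 = (z (0,5) - z (0,1)) / 2 := rfl
  have u6 : u 6 = z (0,4) := rfl
  have p1 : u 0 + u 1 = z (1,5) := by rw [u0, u1]; ring
  have p2 : u 0 - u 1 = z (1,1) := by rw [u0, u1]; ring
  have p3 : u 2 + u 3 = z (1,6) := by rw [u2, u3]; ring
  have p4 : u 2 - u 3 = z (1,0) := by rw [u2, u3]; ring
  have p5 : u 4 + u 5 = z (0,5) := by rw [u4, u5]; ring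
  have p6 : u 4 - u 5 = z (0,1) := by rw [u4, u5]; ring
  have hz : sl u = z := by
    have s00 : sl u (0,0) = (3 + 15 * (u 4 + u 5) * (u 2 - u 3) + 5 * (u 4 - u 5) - 5 * u 6 * (u 0 - u 1)) /
        (15 * (u 0 + u 1)) := rfl
    have s06 : sl u (0,6) = (3 + 15 * (u 4 - u 5) * (u 2 + u 3) + 5 * (u 4 + u 5) + 5 * u 6 * (u 0 + u 1)) /
        (15 * (u 0 - u 1)) := rfl
    obtain ⟨s1, s2, s3, s4, s5, s6, s7, s8, s9, s10, s11, s12⟩ := slv u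
    have r0 : sl u (0,0) = z (0,0) := by
      rw [s00, p1, p2, p4, p5, p6, u6]
      field_simp
      linear_combination -e0
    have r6 : sl u (0,6) = z (0,6) := by
      rw [s06, p1, p2, p3, p5, p6, u6]
      field_simp
      linear_combination -e2
    funext p
    revert p
    exact idx_cases r0 (by rw [s1, p6]) (by rw [s2, u6, w5]) (by rw [s3, w1]) (by rw [s4, u6])
      (by rw [s5, p5]) r6 (by rw [s6, p4]) (by rw [s7, p2]) (by rw [s8, w3]) (by rw [s9, w2])
      (by rw [s10, w4]) (by rw [s11, p1]) (by rw [s12, p3])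
  refine ⟨u, ⟨?_, ?_, ?_, ?_, ?_⟩, ?_, ?_⟩
  · rw [u0]; exact div_ne_zero c0 two_ne_zero
  · rw [u3]; exact div_ne_zero D0 two_ne_zero
  · rw [p1]; exact n5
  · rw [p2]; exact n1
  · rw [hz]; exact z1
  · rw [hz]; exact (gx.trans gy).trans gz
  · rw [hz]; exact cz

end


section

theorem u_int {L Ω : Type} [Field L] [Field Ω] [Algebra L Ω] {u : Fin 7 → Ω} (hu : good u)
    (h : ∀ i, wf u i ∈ algebraicClosure L Ω) : ∀ i, u i ∈ algebraicClosure L Ω := by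
  obtain ⟨g0, g3, -⟩ := hu
  have w0 : u 2 ∈ algebraicClosure L Ω := h 0
  have w1 : u 3 ^ 2 ∈ algebraicClosure L Ω := h 1
  have w2 : u 0 ^ 2 ∈ algebraicClosure L Ω := h 2
  have w3 : u 0 * u 1 * u 3 ∈ algebraicClosure L Ω := h 3
  have w4 : u 4 ∈ algebraicClosure L Ω := h 4
  have w5 : u 5 * u 3 ∈ algebraicClosure L Ω := h 5
  have w6 : u 6 * u 0 * u 3 ∈ algebraicClosure L Ω := h 6
  have k3 : u 3 ∈ algebraicClosure L Ω := by
    rw [mem_algebraicClosure_iff'] at w1 ⊢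
    exact IsIntegral.of_pow (by norm_num) w1
  have k0 : u 0 ∈ algebraicClosure L Ω := by
    rw [mem_algebraicClosure_iff'] at w2 ⊢
    exact IsIntegral.of_pow (by norm_num) w2
  have k1 : u 1 ∈ algebraicClosure L Ω := by
    have := div_mem w3 (mul_mem k0 k3)
    have e : u 0 * u 1 * u 3 / (u 0 * u 3) = u 1 := by field_simp
    rwa [e] at this
  have k5 : u 5 ∈ algebraicClosure L Ω := by
    have := div_mem w5 k3
    have e : u 5 * u 3 / u 3 = u 5 := by field_simp
    rwa [e] at this
  have k6 : u 6 ∈ algebraicClosure L Ω := by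
    have := div_mem w6 (mul_mem k0 k3)
    have e : u 6 * u 0 * u 3 / (u 0 * u 3) = u 6 := by field_simp
    rwa [e] at this
  intro i
  fin_cases i <;> assumption

theorem sl_mem {F Ω : Type} [Field F] [Field Ω] [Algebra F Ω] (E : IntermediateField F Ω) {u : Fin 7 → Ω}
    (h : ∀ i, u i ∈ E) (p : Idx) : sl u p ∈ E := by
  have : u = (algebraMap E Ω) ∘ (fun i => (⟨u i, h i⟩ : E)) := rfl
  rw [this, sl_map]
  exact (sl _ p : E).2

theorem w_indep {Ω : Type} [Field Ω] [Algebra ℂ Ω] {v : Idx → Ω} (hv : IsTranscendenceBasis ℂ v)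
    {u : Fin 7 → Ω} (hu : good u) (hc : Cov v 7 (sl u)) : AlgebraicIndependent ℂ (wf u) := by
  obtain ⟨l, hl, h⟩ := hc
  let x : Fin l.length ⊕ Fin 7 → Ω := Sum.elim l.get (wf u)
  have hx : ∀ i, x i ∈ algebraicClosure (IntermediateField.adjoin ℂ (Set.range x)) Ω := by
    intro i
    rw [mem_algebraicClosure_iff]
    exact isAlgebraic_algebraMap (⟨x i, IntermediateField.subset_adjoin _ _ ⟨i, rfl⟩⟩ :
      IntermediateField.adjoin ℂ (Set.range x))
  have hu' := u_int (L := IntermediateField.adjoin ℂ (Set.range x)) hu (fun i => hx (Sum.inr i))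
  have hs := sl_mem _ hu'
  have hv' := h ((algebraicClosure (IntermediateField.adjoin ℂ (Set.range x)) Ω).restrictScalars ℂ)
    (fun a ha => by
      obtain ⟨i, rfl⟩ := List.get_of_mem ha
      exact hx (Sum.inl i)) hs
  have := acl_top hv _ hv'
  have hb : IsTranscendenceBasis ℂ x := by
    refine Algebra.IsAlgebraic.isTranscendenceBasis_of_le_trdeg_of_finite ℂ x ?_
    rw [← hv.cardinalMk_eq_trdeg]
    simp [hl]
  exact hb.1.comp Sum.inr Sum.inr_injective

/-- product of four transvections -/
def tv {R : Type*} [CommRing R] (a b c d : R) : M2 R :=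
  !![1, a; 0, 1] * !![1, 0; b, 1] * !![1, c; 0, 1] * !![1, 0; d, 1]

theorem tv_det {R : Type*} [CommRing R] (a b c d : R) : (tv a b c d).det = 1 := by
  simp [tv, Matrix.det_mul, -Matrix.cons_mul]

theorem tv_map {R S : Type*} [CommRing R] [CommRing S] (f : R →+* S) (a b c d : R) :
    (tv a b c d).map f = tv (f a) (f b) (f c) (f d) := by
  ext i j
  fin_cases i <;> fin_cases j <;> simp [tv, Matrix.mul_apply, Fin.sum_univ_two]

theorem tv_surj {K : Type*} [Field K] (h : M2 K) (hh : h.det = 1) : ∃ a b c d, h = tv a b c d := by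
  rw [Matrix.det_fin_two] at hh
  by_cases hc : h 1 0 = 0
  · have hd : h 1 1 ≠ 0 := by
      intro h0
      rw [hc, h0] at hh
      simp at hh
    refine ⟨-(h 0 0 - h 0 1 - 1) / h 1 1, - h 1 1, -(h 1 1 - 1) / h 1 1, 1, ?_⟩
    rw [hc] at hh
    ext i j
    fin_cases i <;> fin_cases j <;> simp [tv, Matrix.mul_apply, Fin.sum_univ_two, hc] <;> field_simp <;>
      first | linear_combination hh | linear_combination -hh | ring
  · refine ⟨(h 0 0 - 1) / h 1 0, h 1 0, (h 1 1 - 1) / h 1 0, 0, ?_⟩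
    ext i j
    fin_cases i <;> fin_cases j <;> simp [tv, Matrix.mul_apply, Fin.sum_univ_two] <;> field_simp
    · ring
    · linear_combination -hh
    · ring

theorem dens {Ω : Type} [Field Ω] [Algebra ℂ Ω] [IsAlgClosed Ω] (x : Idx → Ω) (n d : MvPolynomial Idx ℂ)
    (a b : Ω)
    (H : ∀ (t : ℂˣ) (m h : M2 ℂ), m.det = 1 → h.det = 1 →
      a * aeval (act (((t : ℂ) • m).map (algebraMap ℂ Ω)) (h.map (algebraMap ℂ Ω)) x) n =
      b * aeval (act (((t : ℂ) • m).map (algebraMap ℂ Ω)) (h.map (algebraMap ℂ Ω)) x) d)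
    (m h : M2 Ω) (hm : IsUnit m.det) (hh : h.det = 1) :
    a * aeval (act m h x) n = b * aeval (act m h x) d := by
  let P := MvPolynomial (Fin 9) Ω
  let pm : M2 P := (X 0 : P) • tv (X 1) (X 2) (X 3) (X 4)
  let ph : M2 P := tv (X 5) (X 6) (X 7) (X 8)
  let f : MvPolynomial Idx ℂ → P := fun n => aeval (act pm ph (fun p => C (x p))) n
  have hf : ∀ (n : MvPolynomial Idx ℂ) (s : Fin 9 → Ω), eval s (f n) =
      aeval (act (s 0 • tv (s 1) (s 2) (s 3) (s 4)) (tv (s 5) (s 6) (s 7) (s 8)) x) n := by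
    intro n s
    have e1 : pm.map (eval s) = s 0 • tv (s 1) (s 2) (s 3) (s 4) := by
      have := tv_map (eval s) (X 1 : P) (X 2) (X 3) (X 4)
      simp only [eval_X] at this
      rw [← this]
      ext i j
      simp [pm]
    have e2 : ph.map (eval s) = tv (s 5) (s 6) (s 7) (s 8) := by
      have := tv_map (eval s) (X 5 : P) (X 6) (X 7) (X 8)
      simp only [eval_X] at this
      exact this
    have e3 : (eval s) ∘ (fun p => C (x p)) = x := by funext p; simp
    have e4 : ∀ p, eval s (act pm ph (fun p => C (x p)) p) =
        act (s 0 • tv (s 1) (s 2) (s 3) (s 4)) (tv (s 5) (s 6) (s 7) (s 8)) x p := by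
      intro p
      rw [act_map, e1, e2, e3]
    have := MvPolynomial.comp_aeval_apply (act pm ph (fun p => C (x p)))
      ((aeval s : P →ₐ[Ω] Ω).restrictScalars ℂ) n
    change (aeval s) (aeval _ n) = _
    refine this.trans ?_
    congr 2
    funext p
    exact e4 p
  let S : Set Ω := Set.range (fun t : ℂˣ => algebraMap ℂ Ω t)
  have : Infinite ℂˣ := Infinite.of_injective
    (fun k : ℕ => Units.mk0 ((k : ℂ) + 1) (Nat.cast_add_one_ne_zero k)) (fun i j hij => by
      simpa [Units.ext_iff] using hij)
  have hS : S.Infinite := by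
    refine Set.infinite_range_of_injective ?_
    intro s t hst
    exact Units.ext ((algebraMap ℂ Ω).injective hst)
  have key : C a * f n = C b * f d := by
    refine MvPolynomial.funext_set (fun _ => S) (fun _ => hS) ?_
    intro s hs
    have hs' : ∀ i, ∃ t : ℂˣ, algebraMap ℂ Ω t = s i := fun i => hs i (Set.mem_univ i)
    choose t ht using hs'
    have := H (t 0) (tv (t 1 : ℂ) (t 2) (t 3) (t 4)) (tv (t 5 : ℂ) (t 6) (t 7) (t 8)) (tv_det _ _ _ _)
      (tv_det _ _ _ _)
    have e1 : ((t 0 : ℂ) • tv (t 1 : ℂ) (t 2) (t 3) (t 4)).map (algebraMap ℂ Ω) =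
        s 0 • tv (s 1) (s 2) (s 3) (s 4) := by
      rw [← ht, ← ht, ← ht, ← ht, ← ht, ← tv_map]
      ext i j
      simp
    rw [e1, tv_map] at this
    simp only [ht] at this
    rw [map_mul, map_mul, hf, hf, eval_C, eval_C]
    exact this
  obtain ⟨r, hr⟩ := IsAlgClosed.exists_pow_nat_eq m.det (n := 2) (by norm_num)
  have r0 : r ≠ 0 := by
    rintro rfl
    rw [← hr] at hm
    simp at hm
  have hm1 : (r⁻¹ • m).det = 1 := by
    rw [Matrix.det_smul, ← hr]
    simp
    field_simp
  obtain ⟨s1, s2, s3, s4, e1⟩ := tv_surj _ hm1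
  obtain ⟨s5, s6, s7, s8, e2⟩ := tv_surj _ hh
  have := congrArg (eval ![r, s1, s2, s3, s4, s5, s6, s7, s8]) key
  rw [map_mul, map_mul, hf, hf, eval_C, eval_C] at this
  have e3 : m = r • tv s1 s2 s3 s4 := by
    rw [← e1, smul_smul, mul_inv_cancel₀ r0, one_smul]
  rw [e3, e2]
  exact this

theorem flip2_flip2 (m : M2 ℂ) : flip2 (flip2 m) = m := by
  ext i j
  fin_cases i <;> fin_cases j <;> simp [flip2]

theorem flip_det (m : M2 ℂ) : (flip2 m).det = m.det := by
  simp [flip2, Matrix.det_fin_two]; ring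

theorem inv_ext {Ω : Type} [Field Ω] [Algebra ℂ Ω] [IsAlgClosed Ω] {n d : MvPolynomial Idx ℂ}
    (H : ∀ γ : SL2 × SL2 × ℂˣ, coordHomAB 1 6 γ.1 γ.2.1 γ.2.2 n * d = coordHomAB 1 6 γ.1 γ.2.1 γ.2.2 d * n)
    {x y : Idx → Ω} (hxy : GRel x y) : aeval x d * aeval y n = aeval x n * aeval y d := by
  obtain ⟨m, h, hm, hh, rfl⟩ := hxy
  refine dens x n d _ _ ?_ m h hm hh
  intro t m h hm hh
  have := congrArg (aeval x) (H (⟨flip2 m, by rw [flip_det, hm]⟩, ⟨h, hh⟩, t))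
  rw [map_mul, map_mul, aeval_coordHom, aeval_coordHom] at this
  simp only [flip2_flip2] at this
  linear_combination this

theorem exists_ne_act {Ω : Type} [Field Ω] [Algebra ℂ Ω] [IsAlgClosed Ω] {d : MvPolynomial Idx ℂ}
    {x y : Idx → Ω} (hxy : GRel x y) (hy : aeval y d ≠ 0) : ∃ m h : M2 ℂ, IsUnit m.det ∧ h.det = 1 ∧
      aeval (act (m.map (algebraMap ℂ Ω)) (h.map (algebraMap ℂ Ω)) x) d ≠ 0 := by
  by_contra! hcon
  obtain ⟨m, h, hm, hh, rfl⟩ := hxy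
  apply hy
  have := dens x d d 1 0 (fun t m h hm hh => by
    rw [hcon _ _ _ hh]
    · simp
    · rw [Matrix.det_smul, hm]; simp) m h hm hh
  simpa using this

end


section

theorem fix_range {L M : Type} [Field L] [Field M] [Algebra L M] [IsAlgClosure L M] [CharZero L] (x : M)
    (h : ∀ τ : M ≃ₐ[L] M, τ x = x) : x ∈ Set.range (algebraMap L M) := by
  have : Algebra.IsAlgebraic L M := IsAlgClosure.isAlgebraic
  have : Normal L M := IsAlgClosure.normal L M
  have : IsGalois L M := ⟨⟩
  exact (InfiniteGalois.mem_range_algebraMap_iff_fixed x).mpr h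

theorem K_le_L {L M : Type} [Field L] [Field M] [Algebra L M] [IsAlgClosure L M] [Algebra ℂ L] [Algebra ℂ M]
    [IsScalarTower ℂ L M] {n d : MvPolynomial Idx ℂ}
    (H : ∀ γ : SL2 × SL2 × ℂˣ, coordHomAB 1 6 γ.1 γ.2.1 γ.2.2 n * d = coordHomAB 1 6 γ.1 γ.2.1 γ.2.2 d * n)
    {u : Fin 7 → M} (hu : good u) (hw : ∀ i, wf u i ∈ Set.range (algebraMap L M))
    (m h : M2 ℂ) (hm : IsUnit m.det) (hh : h.det = 1) (p : Idx → M)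
    (hp : p = act (m.map (algebraMap ℂ M)) (h.map (algebraMap ℂ M)) (sl u)) (hd : aeval p d ≠ 0) :
    aeval p n / aeval p d ∈ Set.range (algebraMap L M) := by
  have : IsAlgClosed M := IsAlgClosure.isAlgClosed L
  have : CharZero L := charZero_of_injective_algebraMap (algebraMap ℂ L).injective
  have : CharZero M := charZero_of_injective_algebraMap (algebraMap ℂ M).injective
  obtain ⟨I, hI⟩ := IsAlgClosed.exists_pow_nat_eq (-1 : M) (n := 2) (by norm_num)
  refine fix_range _ fun τ => ?_
  have hτ : ∀ z : ℂ, τ (algebraMap ℂ M z) = algebraMap ℂ M z := by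
    intro z
    rw [IsScalarTower.algebraMap_apply ℂ L M, τ.commutes]
  have hwf : wf (τ.toRingEquiv.toRingHom ∘ u) = wf u := by
    rw [wf_map]
    funext i
    obtain ⟨y, hy⟩ := hw i
    change τ (wf u i) = wf u i
    rw [← hy, τ.commutes]
  have g1 : GRel (sl u) (τ.toRingEquiv.toRingHom ∘ sl u) := by
    have := claimV I hI u _ hu hwf
    rwa [sl_map] at this
  have hmap : ∀ k : M2 ℂ, (k.map (algebraMap ℂ M)).map τ.toRingEquiv.toRingHom = k.map (algebraMap ℂ M) := by
    intro k
    ext i j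
    exact hτ _
  have g2 : GRel (sl u) p := ⟨_, _, by
    rw [← RingHom.mapMatrix_apply, ← RingHom.map_det]; exact hm.map _, by
    rw [← RingHom.mapMatrix_apply, ← RingHom.map_det, hh, map_one], hp⟩
  have g3 : GRel (τ.toRingEquiv.toRingHom ∘ sl u) (τ.toRingEquiv.toRingHom ∘ p) := by
    obtain ⟨m', h', k1, k2, k3⟩ := g2
    refine ⟨m'.map τ.toRingEquiv.toRingHom, h'.map τ.toRingEquiv.toRingHom, ?_, ?_, ?_⟩
    · rw [← RingHom.mapMatrix_apply, ← RingHom.map_det]; exact k1.map _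
    · rw [← RingHom.mapMatrix_apply, ← RingHom.map_det, k2, map_one]
    · funext q
      rw [k3]
      exact act_map _ _ _ _ _
  have g4 : GRel p (τ.toRingEquiv.toRingHom ∘ p) := (g2.symm.trans g1).trans g3
  have e := inv_ext H g4
  have ev : ∀ f : MvPolynomial Idx ℂ, aeval (τ.toRingEquiv.toRingHom ∘ p) f = τ (aeval p f) := by
    intro f
    exact (MvPolynomial.comp_aeval_apply p (τ.toAlgHom.restrictScalars ℂ) f).symm
  rw [ev, ev] at e
  have hd' : τ (aeval p d) ≠ 0 := by simpa using hd
  rw [map_div₀]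
  field_simp
  linear_combination e

theorem ext_hom {F Ω Ω' : Type} [Field F] [Field Ω] [Field Ω'] [Algebra F Ω] [Algebra.IsAlgebraic F Ω]
    [IsAlgClosed Ω'] (f : F →+* Ω') : ∃ τ : Ω →+* Ω', ∀ a, τ (algebraMap F Ω a) = f a := by
  letI := f.toAlgebra
  let g : Ω →ₐ[F] Ω' := IsAlgClosed.lift
  exact ⟨g.toRingHom, fun a => g.commutes a⟩

theorem coordHom_inj (γ : SL2 × SL2 × ℂˣ) : Function.Injective (coordHomAB 1 6 γ.1 γ.2.1 γ.2.2) := by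
  rw [injective_iff_map_eq_zero]
  intro n hn
  refine MvPolynomial.funext fun x => ?_
  have h1 : IsUnit ((((γ.2.2 : ℂ) • flip2 γ.1.1).map (algebraMap ℂ ℂ)) : M2 ℂ).det := by
    have : (((γ.2.2 : ℂ) • flip2 γ.1.1).map (algebraMap ℂ ℂ) : M2 ℂ) = (γ.2.2 : ℂ) • flip2 γ.1.1 := by
      ext i j; simp
    rw [this, Matrix.det_smul, flip_det, γ.1.2]
    simp
  have h2 : ((γ.2.1.1.map (algebraMap ℂ ℂ)) : M2 ℂ).det = 1 := by
    have : ((γ.2.1.1.map (algebraMap ℂ ℂ)) : M2 ℂ) = γ.2.1.1 := by ext i j; simp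
    rw [this, γ.2.1.2]
  have e : act (((γ.2.2 : ℂ) • flip2 γ.1.1).map (algebraMap ℂ ℂ)) (γ.2.1.1.map (algebraMap ℂ ℂ))
      (act (((γ.2.2 : ℂ) • flip2 γ.1.1).map (algebraMap ℂ ℂ))⁻¹
        (γ.2.1.1.map (algebraMap ℂ ℂ)).adjugate x) = x := by
    rw [act_act, Matrix.mul_nonsing_inv _ h1, Matrix.adjugate_mul, h2, one_smul, act_one]
  have := aeval_coordHom γ.1 γ.2.1 γ.2.2 n (act (((γ.2.2 : ℂ) • flip2 γ.1.1).map (algebraMap ℂ ℂ))⁻¹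
        (γ.2.1.1.map (algebraMap ℂ ℂ)).adjugate x)
  rw [e, hn, map_zero] at this
  rw [map_zero, ← MvPolynomial.coe_aeval_eq_eval]
  exact this.symm

theorem grel_coord {Ω : Type} [Field Ω] [Algebra ℂ Ω] (γ : SL2 × SL2 × ℂˣ) (v : Idx → Ω) :
    GRel v (fun q => aeval v (coordHomAB 1 6 γ.1 γ.2.1 γ.2.2 (X q))) := by
  refine ⟨((γ.2.2 : ℂ) • flip2 γ.1.1).map (algebraMap ℂ Ω), γ.2.1.1.map (algebraMap ℂ Ω), ?_, ?_, ?_⟩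
  · rw [← RingHom.mapMatrix_apply, ← RingHom.map_det, Matrix.det_smul, flip_det, γ.1.2]
    simp
  · rw [← RingHom.mapMatrix_apply, ← RingHom.map_det, γ.2.1.2, map_one]
  · funext q
    rw [aeval_coordHom, aeval_X]

end


theorem good_of_map {K K' : Type} [Field K] [Field K'] (f : K →+* K') (u : Fin 7 → K) (h : good (f ∘ u)) :
    good u := by
  obtain ⟨h1, h2, h3, h4, h5⟩ := h
  refine ⟨?_, ?_, ?_, ?_, ?_⟩
  · simpa using h1
  · simpa using h2
  · intro e; apply h3; simp only [Function.comp]; rw [← map_add, e, map_zero]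
  · intro e; apply h4; simp only [Function.comp]; rw [← map_sub, e, map_zero]
  · intro e; apply h5; rw [sl_map, q1_map, e, map_zero]

/-- wf is constant under field endomorphisms that move `v` inside its orbit -/
theorem tau_wf {Ω : Type} [Field Ω] [CharZero Ω] {v : Idx → Ω} {u : Fin 7 → Ω} (hu : good u)
    (g : GRel v (sl u)) (τ : Ω →+* Ω) (hτ : GRel v (τ ∘ v)) : ∀ i, τ (wf u i) = wf u i := by
  have g2 : GRel (sl u) (sl (τ ∘ u)) := by
    rw [sl_map]
    exact (g.symm.trans hτ).trans (g.map τ)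
  have := claimU u (τ ∘ u) hu (good_map τ u hu) g2
  rw [wf_map] at this
  exact fun i => congrFun this i

theorem GRel.rfl' {R : Type*} [CommRing R] (x : Idx → R) : GRel x x :=
  ⟨1, 1, by simp, by simp, (act_one x).symm⟩

section
variable {F Ω : Type} [Field F] [Algebra ℂ F] [Algebra (MvPolynomial Idx ℂ) F]
  [IsFractionRing (MvPolynomial Idx ℂ) F] [IsScalarTower ℂ (MvPolynomial Idx ℂ) F]
  [Field Ω] [Algebra F Ω] [Algebra ℂ Ω] [IsScalarTower ℂ F Ω] [IsAlgClosure F Ω]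

def vv (F Ω : Type) [Field F] [Algebra (MvPolynomial Idx ℂ) F] [Field Ω] [Algebra F Ω] : Idx → Ω :=
  fun q => algebraMap F Ω (algebraMap (MvPolynomial Idx ℂ) F (X q))

theorem aeval_vv (n : MvPolynomial Idx ℂ) :
    aeval (vv F Ω) n = algebraMap F Ω (algebraMap (MvPolynomial Idx ℂ) F n) := by
  have : (aeval (vv F Ω) : MvPolynomial Idx ℂ →ₐ[ℂ] Ω) =
      (IsScalarTower.toAlgHom ℂ F Ω).comp (IsScalarTower.toAlgHom ℂ (MvPolynomial Idx ℂ) F) := by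
    ext q
    simp [vv]
  rw [this]
  rfl

theorem vv_basis : IsTranscendenceBasis ℂ (vv F Ω) := by
  have : Algebra.IsAlgebraic F Ω := IsAlgClosure.isAlgebraic
  have h1 := IsTranscendenceBasis.mvPolynomial Idx ℂ
  have : Algebra.IsAlgebraic (MvPolynomial Idx ℂ) F := IsLocalization.isAlgebraic _ (nonZeroDivisors (MvPolynomial Idx ℂ))
  have : FaithfulSMul (MvPolynomial Idx ℂ) F :=
    (faithfulSMul_iff_algebraMap_injective _ _).mpr (IsFractionRing.injective _ _)
  have h2 : IsTranscendenceBasis ℂ (algebraMap (MvPolynomial Idx ℂ) F ∘ X) := h1.algebraMap_comp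
  exact h2.algebraMap_comp (A := Ω)

theorem w_range {u : Fin 7 → Ω} (hu : good u) (g : GRel (vv F Ω) (sl u)) (i : Fin 7) :
    wf u i ∈ Set.range (algebraMap F Ω) := by
  have : CharZero F := charZero_of_injective_algebraMap (algebraMap ℂ F).injective
  have : CharZero Ω := charZero_of_injective_algebraMap (algebraMap ℂ Ω).injective
  refine fix_range _ fun τ => ?_
  refine tau_wf hu g τ.toRingEquiv.toRingHom ?_ i
  have : τ.toRingEquiv.toRingHom ∘ vv F Ω = vv F Ω := by
    funext q
    exact τ.commutes _
  rw [this]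
  exact GRel.rfl' _

theorem w_inv {u : Fin 7 → Ω} (hu : good u) (g : GRel (vv F Ω) (sl u)) (i : Fin 7) (n d : MvPolynomial Idx ℂ)
    (hd : d ≠ 0)
    (e : algebraMap F Ω (algebraMap (MvPolynomial Idx ℂ) F n / algebraMap (MvPolynomial Idx ℂ) F d) = wf u i)
    (γ : SL2 × SL2 × ℂˣ) : 
    coordHomAB 1 6 γ.1 γ.2.1 γ.2.2 n * d = coordHomAB 1 6 γ.1 γ.2.1 γ.2.2 d * n := by
  have : Algebra.IsAlgebraic F Ω := IsAlgClosure.isAlgebraic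
  have : IsAlgClosed Ω := IsAlgClosure.isAlgClosed F
  have : CharZero Ω := charZero_of_injective_algebraMap (algebraMap ℂ Ω).injective
  have hinj : Function.Injective ((algebraMap F Ω).comp (algebraMap (MvPolynomial Idx ℂ) F)) :=
    (algebraMap F Ω).injective.comp (IsFractionRing.injective _ _)
  have hinj2 : Function.Injective (((algebraMap F Ω).comp (algebraMap (MvPolynomial Idx ℂ) F)).comp
      (coordHomAB 1 6 γ.1 γ.2.1 γ.2.2).toRingHom) := hinj.comp (coordHom_inj γ)
  obtain ⟨τ, hτ⟩ := ext_hom (Ω := Ω) (IsFractionRing.lift (K := F) hinj2)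
  have hτ' : ∀ a : MvPolynomial Idx ℂ, τ (algebraMap F Ω (algebraMap _ F a)) =
      algebraMap F Ω (algebraMap _ F (coordHomAB 1 6 γ.1 γ.2.1 γ.2.2 a)) := by
    intro a
    rw [hτ, IsFractionRing.lift_algebraMap]
    rfl
  have k := tau_wf hu g τ (by
    have : τ ∘ vv F Ω = fun q => aeval (vv F Ω) (coordHomAB 1 6 γ.1 γ.2.1 γ.2.2 (X q)) := by
      funext q
      rw [aeval_vv]
      exact hτ' _
    rw [this]
    exact grel_coord γ _) i
  rw [← e, map_div₀, map_div₀, hτ', hτ'] at k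
  have z1 : algebraMap F Ω (algebraMap _ F d) ≠ 0 := fun h => hd (hinj (by simpa using h))
  have z2 : algebraMap F Ω (algebraMap _ F (coordHomAB 1 6 γ.1 γ.2.1 γ.2.2 d)) ≠ 0 :=
    fun h => hd (hinj2 (by simpa using h))
  rw [div_eq_div_iff z2 z1] at k
  apply hinj
  simp only [RingHom.comp_apply, map_mul]
  rw [k]
  ring

theorem inv_le {u : Fin 7 → Ω} (hu : good u) (g : GRel (vv F Ω) (sl u)) (w : Fin 7 → F)
    (hw : ∀ i, algebraMap F Ω (w i) = wf u i) (n d : MvPolynomial Idx ℂ) (hd : d ≠ 0)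
    (H : ∀ γ : SL2 × SL2 × ℂˣ, coordHomAB 1 6 γ.1 γ.2.1 γ.2.2 n * d = coordHomAB 1 6 γ.1 γ.2.1 γ.2.2 d * n) :
    algebraMap (MvPolynomial Idx ℂ) F n / algebraMap (MvPolynomial Idx ℂ) F d ∈
      IntermediateField.adjoin ℂ (Set.range w) := by
  have : IsAlgClosed Ω := IsAlgClosure.isAlgClosed F
  have hinj : Function.Injective ((algebraMap F Ω).comp (algebraMap (MvPolynomial Idx ℂ) F)) :=
    (algebraMap F Ω).injective.comp (IsFractionRing.injective _ _)
  have zd : aeval (vv F Ω) d ≠ 0 := by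
    rw [aeval_vv]
    exact fun h => hd (hinj (by simpa using h))
  let L := IntermediateField.adjoin ℂ (Set.range w)
  let M := algebraicClosure L Ω
  have hwL : ∀ i, wf u i = algebraMap L Ω ⟨w i, IntermediateField.subset_adjoin _ _ ⟨i, rfl⟩⟩ := by
    intro i
    rw [← hw i]
    rfl
  have huM : ∀ i, u i ∈ M := u_int hu fun i => by
    rw [hwL i]
    exact IntermediateField.algebraMap_mem _ _
  let uM : Fin 7 → M := fun i => ⟨u i, huM i⟩
  have hcomp : algebraMap M Ω ∘ uM = u := rfl
  have huM' : good uM := good_of_map (algebraMap M Ω) uM hu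
  have hwM : ∀ i, wf uM i ∈ Set.range (algebraMap L M) := by
    intro i
    refine ⟨⟨w i, IntermediateField.subset_adjoin _ _ ⟨i, rfl⟩⟩, ?_⟩
    apply (algebraMap M Ω).injective
    have := congrFun (wf_map (algebraMap M Ω) uM) i
    rw [hcomp, hwL i] at this
    rw [← IsScalarTower.algebraMap_apply L M Ω]
    exact this
  obtain ⟨m, h, hm, hh, hne⟩ := exists_ne_act g.symm zd
  let p : Idx → M := act (m.map (algebraMap ℂ M)) (h.map (algebraMap ℂ M)) (sl uM)
  have hpp : algebraMap M Ω ∘ p = act (m.map (algebraMap ℂ Ω)) (h.map (algebraMap ℂ Ω)) (sl u) := by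
    funext q
    rw [Function.comp, act_map, ← sl_map, hcomp]
    rfl
  have hst : IsScalarTower ℂ M Ω := by
    refine IsScalarTower.of_algebraMap_eq fun z => ?_
    rfl
  have hev : ∀ f : MvPolynomial Idx ℂ, algebraMap M Ω (aeval p f) = aeval (algebraMap M Ω ∘ p) f := by
    intro f
    exact MvPolynomial.comp_aeval_apply p (IsScalarTower.toAlgHom ℂ M Ω) f
  rw [← hpp] at hne
  have hne' : aeval p d ≠ 0 := by
    intro z
    rw [← hev, z, map_zero] at hne
    exact hne rfl
  obtain ⟨y, hy⟩ := K_le_L (L := L) (M := M) H huM' hwM m h hm hh p rfl hne'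
  have gp : GRel (vv F Ω) (algebraMap M Ω ∘ p) := by
    refine g.trans ⟨_, _, ?_, ?_, hpp⟩
    · rw [← RingHom.mapMatrix_apply, ← RingHom.map_det]; exact hm.map _
    · rw [← RingHom.mapMatrix_apply, ← RingHom.map_det, hh, map_one]
  have e := inv_ext H gp
  have key : algebraMap F Ω (algebraMap (MvPolynomial Idx ℂ) F n / algebraMap (MvPolynomial Idx ℂ) F d)
      = algebraMap F Ω (y : F) := by
    have hy2 := congrArg (algebraMap M Ω) hy
    rw [map_div₀, hev, hev, ← IsScalarTower.algebraMap_apply L M Ω] at hy2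
    change algebraMap F Ω (y : F) = _ at hy2
    rw [hy2, map_div₀, ← aeval_vv, ← aeval_vv, div_eq_div_iff zd hne]
    linear_combination -e
  rw [(algebraMap F Ω).injective key]
  exact y.2

theorem main_abs (K : IntermediateField ℂ F) (hK : ∀ x, x ∈ K ↔ ∃ n d : MvPolynomial Idx ℂ, d ≠ 0 ∧
      x = algebraMap _ F n / algebraMap _ F d ∧ ∀ γ : SL2 × SL2 × ℂˣ,
        coordHomAB 1 6 γ.1 γ.2.1 γ.2.2 n * d = coordHomAB 1 6 γ.1 γ.2.1 γ.2.2 d * n) (Ω : Type)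
  [Field Ω] [Algebra F Ω] [Algebra ℂ Ω] [IsScalarTower ℂ F Ω] [IsAlgClosure F Ω] :
    ∃ w : Fin 7 → F, AlgebraicIndependent ℂ w ∧ IntermediateField.adjoin ℂ (Set.range w) = K := by
  have : IsAlgClosed Ω := IsAlgClosure.isAlgClosed F
  have : CharZero Ω := charZero_of_injective_algebraMap (algebraMap ℂ Ω).injective
  have hv : IsTranscendenceBasis ℂ (vv F Ω) := vv_basis
  obtain ⟨u, hu, g, hc⟩ := exists_slice hv
  have hw := w_indep hv hu hc
  choose w hwF using w_range hu g
  refine ⟨w, ?_, le_antisymm ?_ ?_⟩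
  · refine AlgebraicIndependent.of_comp (IsScalarTower.toAlgHom ℂ F Ω) ?_
    have : (IsScalarTower.toAlgHom ℂ F Ω) ∘ w = wf u := funext hwF
    rwa [this]
  · rw [IntermediateField.adjoin_le_iff]
    rintro _ ⟨i, rfl⟩
    obtain ⟨n, d, hd, e⟩ := IsFractionRing.div_surjective (A := MvPolynomial Idx ℂ) (w i)
    have hd0 : d ≠ 0 := nonZeroDivisors.ne_zero hd
    refine (hK _).mpr ⟨n, d, hd0, e.symm, w_inv hu g i n d hd0 ?_⟩
    rw [e, hwF]
  · intro x hx
    obtain ⟨n, d, hd, rfl, H⟩ := (hK x).mp hx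
    exact inv_le hu g w hwF n d hd H

end

/-- **Rationality of `P(V_{1,6}) / (SL₂(ℂ) × SL₂(ℂ))`**: the field of invariant rational
functions is purely transcendental over `ℂ` of transcendence degree 7. -/
theorem quotient_rational_1_6 :
    Nonempty ((invFieldAB 1 6) ≃ₐ[ℂ] FractionRing (MvPolynomial (Fin 7) ℂ)) := by
  obtain ⟨w, hw, e⟩ := main_abs (F := FractionRing (MvPolynomial Idx ℂ)) (invFieldAB 1 6)
    (fun x => Iff.rfl) (AlgebraicClosure (FractionRing (MvPolynomial Idx ℂ)))
  exact ⟨((IntermediateField.equivOfEq e).symm).trans hw.aevalEquivField.symm⟩
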